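/- arXiv:2011.07890 — 3 statements merged into one kernel-verified Lean document; each statement's English description precedes it below -/
import Mathlib

section
/- Fix reals 0<q<1, 0<a≤1 and η,θ>0 and set Q=q^η, Q̃=q^θ, and let 1≤M≤N≤∞. Then the sum, over all (M,N)-based plane partitions Λ, of Q^{left vol(Λ)}·(a√(QQ̃))^{central vol(Λ)}·Q̃^{right vol(Λ)} converges and equals ∏_{1≤i≤M}∏_{1≤j≤N}(1−a·Q^{i−1/2}·Q̃^{j−1/2})^{−1}. -/
open MeasureTheory Filter Topology Set

noncomputable section



/-- An `(M,N)`-based plane partition, with 0-based indices: the entry `part i j`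
corresponds to `Λ_{i+1,j+1}`. -/
structure PlanePartition (M N : ℕ∞) where
  part : ℕ → ℕ → ℕ
  antitone_fst : ∀ i j, part (i + 1) j ≤ part i j
  antitone_snd : ∀ i j, part i (j + 1) ≤ part i j
  supp_fst : ∀ i j : ℕ, M ≤ (i : ℕ∞) → part i j = 0
  supp_snd : ∀ i j : ℕ, N ≤ (j : ℕ∞) → part i j = 0
  finite_supp : {p : ℕ × ℕ | part p.1 p.2 ≠ 0}.Finite

/-- Left volume: sum of the entries strictly to the left of the diagonal. -/
def PlanePartition.leftVol {M N : ℕ∞} (Λ : PlanePartition M N) : ℕ :=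
  ∑ᶠ p : ℕ × ℕ, if p.2 < p.1 then Λ.part p.1 p.2 else 0

/-- Central volume (trace): sum of the diagonal entries. -/
def PlanePartition.centralVol {M N : ℕ∞} (Λ : PlanePartition M N) : ℕ :=
  ∑ᶠ i : ℕ, Λ.part i i

/-- Right volume: sum of the entries strictly to the right of the diagonal. -/
def PlanePartition.rightVol {M N : ℕ∞} (Λ : PlanePartition M N) : ℕ :=
  ∑ᶠ p : ℕ × ℕ, if p.1 < p.2 then Λ.part p.1 p.2 else 0

/-- The Muttalib–Borodin weight `Q^{left vol} (a √(Q Q̃))^{central vol} Q̃^{right vol}`,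
where `Q = q^η` and `Q̃ = q^θ`. -/
def mbWeight (q a η θ : ℝ) {M N : ℕ∞} (Λ : PlanePartition M N) : ℝ :=
  (q ^ η) ^ Λ.leftVol * (a * Real.sqrt ((q ^ η) * (q ^ θ))) ^ Λ.centralVol *
    (q ^ θ) ^ Λ.rightVol

/-- The probability of the event `E` under the Muttalib–Borodin measure on
`(M,N)`-based plane partitions. -/
def mbProb (q a η θ : ℝ) (M N : ℕ∞) (E : Set (PlanePartition M N)) : ℝ :=
  (∑' Λ : E, mbWeight q a η θ Λ.1) / (∑' Λ : PlanePartition M N, mbWeight q a η θ Λ)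

/-- The Fredholm series `det(1-K)_{L²(X)}
  = 1 + ∑_{m ≥ 1} ((-1)^m/m!) ∫_{X^m} det[K(x_i,x_j)] dx₁⋯dx_m`. -/
def fredholmDet (K : ℝ → ℝ → ℂ) (X : Set ℝ) : ℂ :=
  1 + ∑' m : ℕ,
    ((-1 : ℂ) ^ (m + 1) / (m + 1).factorial) *
      ∫ x : Fin (m + 1) → ℝ in {x | ∀ i, x i ∈ X},
        Matrix.det (Matrix.of fun i j => K (x i) (x j))

/-- `F_he(ζ) = Γ(α/(2η) - ζ/η + 1/2) / Γ(α/(2θ) + ζ/θ + 1/2)`. -/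
def Fhe (α η θ : ℝ) (ζ : ℂ) : ℂ :=
  Complex.Gamma (α / (2 * η) - ζ / η + 1 / 2) / Complex.Gamma (α / (2 * θ) + ζ / θ + 1 / 2)

/-- The hard-edge kernel `K_he(x,y)`, a double contour integral over the vertical lines
`δ + iℝ` (in `ζ`) and `-δ + iℝ` (in `ω`), with the (valid) choice `δ = min(η,θ)/4`. -/
def Khe (α η θ : ℝ) (x y : ℝ) : ℂ :=
  (((x * y) ^ (-(1 / 2) : ℝ) : ℝ) : ℂ) * ((2 * Real.pi * Complex.I) ^ 2)⁻¹ *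
    ∫ t : ℝ, (∫ s : ℝ,
      (Fhe α η θ (min η θ / 4 + t * Complex.I) / Fhe α η θ (-(min η θ / 4) + s * Complex.I)) *
        (x : ℂ) ^ (min η θ / 4 + t * Complex.I) * (y : ℂ) ^ (-(-(min η θ / 4) + s * Complex.I)) /
        ((min η θ / 4 + t * Complex.I) - (-(min η θ / 4) + s * Complex.I)) * Complex.I) *
      Complex.I

/-- `K̃_he(x,y) = e^{-x/2-y/2} K_he(e^{-x}, e^{-y})`. -/
def Kthe (α η θ : ℝ) (x y : ℝ) : ℂ :=
  Real.exp (-x / 2 - y / 2) * Khe α η θ (Real.exp (-x)) (Real.exp (-y))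




/-- The infinite q-Pochhammer symbol `(x;u)_∞ = ∏_{i ≥ 0} (1 - x u^i)` in `ℂ`. -/
def qPochInf (x u : ℂ) : ℂ := ∏' i : ℕ, (1 - x * u ^ i)

/-- The point `r e^{iφ}` on the circle of radius `r`. -/
def zCirc (r φ : ℝ) : ℂ := (r : ℂ) * Complex.exp (φ * Complex.I)

/-- `F_d(z) = (√a Q̃^{1/2}/z; Q̃)_∞ / (√a Q^{1/2} z; Q)_∞` with `Q = q^η`, `Q̃ = q^θ`
(the case `M = N = ∞`). -/
def Fd (q a η θ : ℝ) (z : ℂ) : ℂ :=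
  qPochInf (((Real.sqrt a * (q ^ θ) ^ ((1 : ℝ) / 2) : ℝ) : ℂ) / z) ((q ^ θ : ℝ) : ℂ) /
    qPochInf (((Real.sqrt a * (q ^ η) ^ ((1 : ℝ) / 2) : ℝ) : ℂ) * z) ((q ^ η : ℝ) : ℂ)

/-- A (valid) choice of the contour parameter `δ` for the discrete kernel:
`√a Q̃^{1/2} < 1 - δ` and `(1 + δ) √a Q^{1/2} < 1`. -/
def ddelta (q a η θ : ℝ) : ℝ :=
  min ((1 - Real.sqrt a * (q ^ θ) ^ ((1 : ℝ) / 2)) / 2)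
    (((Real.sqrt a * (q ^ η) ^ ((1 : ℝ) / 2))⁻¹ - 1) / 2)

/-- The discrete kernel `K_d(k,ℓ)` with `M = N = ∞`, evaluated at the half-integers
`k = κ + 1/2` and `ℓ = l + 1/2`; note that then `z^{-k+1/2} = z^{-κ}` and
`w^{ℓ+1/2} = w^{l+1}` are integer powers. -/
def Kd (q a η θ : ℝ) (κ l : ℤ) : ℂ :=
  ((2 * Real.pi : ℂ) ^ 2)⁻¹ *
    ∫ φ in Set.Ioc (-Real.pi) Real.pi, ∫ ψ in Set.Ioc (-Real.pi) Real.pi,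
      Fd q a η θ (zCirc (1 + ddelta q a η θ) φ) / Fd q a η θ (zCirc (1 - ddelta q a η θ) ψ) *
        zCirc (1 + ddelta q a η θ) φ ^ (-κ) * zCirc (1 - ddelta q a η θ) ψ ^ (l + 1) /
        (zCirc (1 + ddelta q a η θ) φ - zCirc (1 - ddelta q a η θ) ψ)

/-- The Airy kernel, as a double contour integral over the vertical lines `1 + iℝ`
(in `ζ`) and `-1 + iℝ` (in `ω`). -/
def airyKernel (x y : ℝ) : ℂ :=
  ((2 * Real.pi * Complex.I) ^ 2)⁻¹ *
    ∫ t : ℝ, (∫ s : ℝ,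
      Complex.exp ((1 + t * Complex.I) ^ 3 / 3 - x * (1 + t * Complex.I)) *
        Complex.exp (-(-1 + s * Complex.I) ^ 3 / 3 + y * (-1 + s * Complex.I)) /
        ((1 + t * Complex.I) - (-1 + s * Complex.I)) * Complex.I) * Complex.I

/-- The dilogarithm `Li₂(t) = ∑_{k ≥ 1} t^k / k²`. -/
def Li2 (t : ℝ) : ℝ := ∑' k : ℕ, t ^ (k + 1) / ((k : ℝ) + 1) ^ 2

/-- The saddle point `z_c` associated to `(a, η, θ)` (with `b = √a`). -/
def zc (a η θ : ℝ) : ℝ :=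
  (Real.sqrt a * (θ - η) + Real.sqrt (4 * η * θ + a * (θ - η) ^ 2)) / (2 * θ)

/-- `v_c = -η⁻¹ log(1 - b z_c) - θ⁻¹ log(1 - b / z_c)`; this is the constant `c₁`. -/
def vc (a η θ : ℝ) : ℝ :=
  -η⁻¹ * Real.log (1 - Real.sqrt a * zc a η θ) - θ⁻¹ * Real.log (1 - Real.sqrt a / zc a η θ)

/-- The action `S(z) = η⁻¹ Li₂(b z) - θ⁻¹ Li₂(b / z) - v_c log z`. -/
def Sfun (a η θ : ℝ) (z : ℝ) : ℝ :=
  η⁻¹ * Li2 (Real.sqrt a * z) - θ⁻¹ * Li2 (Real.sqrt a / z) - vc a η θ * Real.log z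

/-- The constant `c₂ = ((1/2) ((z d/dz)³ S)(z_c))^{1/3}`. -/
def c2const (a η θ : ℝ) : ℝ :=
  ((1 / 2) * ((fun f : ℝ → ℝ => fun z => z * deriv f z)^[3] (Sfun a η θ)) (zc a η θ)) ^
    ((1 : ℝ) / 3)

/-- The finite q-Pochhammer symbol `(x;u)_n = ∏_{0 ≤ i < n} (1 - x u^i)` in `ℝ`. -/
def qPoch (x u : ℝ) (n : ℕ) : ℝ := ∏ i ∈ Finset.range n, (1 - x * u ^ i)

/-- The density (unnormalized) of the continuous Muttalib–Borodin ensemble. -/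
def mbDensity (α η θ : ℝ) (M N : ℕ) (x : Fin M → ℝ) : ℝ :=
  (∏ i : Fin M, ∏ j : Fin M,
      if i < j then (x j ^ η - x i ^ η) * (x j ^ θ - x i ^ θ) else 1) *
    ∏ i : Fin M, x i ^ (α + (η + θ) / 2 - 1) * (1 - x i ^ θ) ^ (N - M)

/-- The probability of the event `E` under the continuous Muttalib–Borodin ensemble with
parameters `(α, η, θ, M, N)`, defined as a ratio of integrals over ordered tuples
`0 < x₁ < ⋯ < x_M < 1`. -/
def contMBProb (α η θ : ℝ) (M N : ℕ) (E : Set (Fin M → ℝ)) : ℝ :=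
  (∫ x in {x : Fin M → ℝ | (∀ i, 0 < x i ∧ x i < 1) ∧ StrictMono x ∧ x ∈ E},
      mbDensity α η θ M N x) /
    ∫ x in {x : Fin M → ℝ | (∀ i, 0 < x i ∧ x i < 1) ∧ StrictMono x},
      mbDensity α η θ M N x

/-- A step of a ↘-path: one coordinate increases by exactly 1. -/
def DRStep (p q : ℕ × ℕ) : Prop :=
  (q.1 = p.1 + 1 ∧ q.2 = p.2) ∨ (q.1 = p.1 ∧ q.2 = p.2 + 1)

/-- A step of a ↗-path: the first coordinate decreases by 1, or the second increases by 1. -/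
def URStep (p q : ℕ × ℕ) : Prop :=
  (q.1 + 1 = p.1 ∧ q.2 = p.2) ∨ (q.1 = p.1 ∧ q.2 = p.2 + 1)

/-- Bessel function of the first kind (series form), for `t > 0`. -/
def besselJ (α t : ℝ) : ℝ :=
  ∑' k : ℕ, (-1 : ℝ) ^ k * (t / 2) ^ (2 * (k : ℝ) + α) /
    ((k.factorial : ℝ) * Real.Gamma ((k : ℝ) + α + 1))


namespace MBP

/-- Interlacing. -/
def Il (μ l : ℕ →₀ ℕ) : Prop := ∀ i, μ i ≤ l i ∧ l (i + 1) ≤ μ i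

open Classical in
/-- One-variable branching kernel. -/
def T (x : ENNReal) (μ l : ℕ →₀ ℕ) : ENNReal :=
  if Il μ l then x ^ (l.degree - μ.degree) else 0

lemma degree_eq (f : ℕ →₀ ℕ) (n : ℕ) (h : ∀ i, n ≤ i → f i = 0) :
    f.degree = ∑ i ∈ Finset.range n, f i := by
  rw [Finsupp.degree_apply]
  apply Finset.sum_subset
  · intro i hi
    by_contra hc
    simp at hi hc
    exact hi (h i hc)
  · intro i _ hi
    simpa using hi

lemma exists_bound (f : ℕ →₀ ℕ) : ∃ n, ∀ i, n ≤ i → f i = 0 := by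
  refine ⟨f.support.sup id + 1, fun i hi => ?_⟩
  by_contra hc
  have : i ≤ f.support.sup id := Finset.le_sup (f := id) (by simpa using hc)
  omega

lemma Il.degree_le {μ l : ℕ →₀ ℕ} (h : Il μ l) : μ.degree ≤ l.degree := by
  obtain ⟨n, hn⟩ := exists_bound l
  rw [degree_eq l n hn, degree_eq μ n (fun i hi => by have := (h i).1; rw [hn i hi] at this; omega)]
  exact Finset.sum_le_sum fun i _ => (h i).1

/-- toggled sequence -/
def togFun (α β : ℕ →₀ ℕ) (k : ℕ) (μ : ℕ →₀ ℕ) : ℕ → ℕ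
  | 0 => max (α 0) (β 0) + k
  | i + 1 => max (α (i + 1)) (β (i + 1)) + min (α i) (β i) - μ i

lemma tog_fin (α β : ℕ →₀ ℕ) (k : ℕ) (μ : ℕ →₀ ℕ) :
    (Function.support (togFun α β k μ)).Finite := by
  obtain ⟨n, hn⟩ := exists_bound α
  obtain ⟨m, hm⟩ := exists_bound β
  apply (Finset.finite_toSet (Finset.range (n + m + 1))).subset
  intro i hi
  by_contra hc
  simp at hc
  apply hi
  obtain ⟨j, rfl⟩ : ∃ j, i = j + 1 := ⟨i - 1, by omega⟩
  simp [togFun, hn j (by omega), hn (j+1) (by omega), hm j (by omega), hm (j+1) (by omega)]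

def tog (α β : ℕ →₀ ℕ) (k : ℕ) (μ : ℕ →₀ ℕ) : ℕ →₀ ℕ :=
  Finsupp.ofSupportFinite (togFun α β k μ) (tog_fin α β k μ)

lemma tog_zero (α β : ℕ →₀ ℕ) (k : ℕ) (μ : ℕ →₀ ℕ) :
    tog α β k μ 0 = max (α 0) (β 0) + k := rfl

lemma tog_succ (α β : ℕ →₀ ℕ) (k : ℕ) (μ : ℕ →₀ ℕ) (i : ℕ) :
    tog α β k μ (i + 1) = max (α (i + 1)) (β (i + 1)) + min (α i) (β i) - μ i := rfl

lemma tog_il {α β μ : ℕ →₀ ℕ} (k : ℕ) (h1 : Il μ α) (h2 : Il μ β) :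
    Il α (tog α β k μ) ∧ Il β (tog α β k μ) := by
  constructor <;> intro i <;> have a1 := h1 i <;> have a2 := h2 i <;> rw [tog_succ] <;>
    (cases i with
    | zero => rw [tog_zero]; omega
    | succ j => have b1 := h1 j; have b2 := h2 j; rw [tog_succ]; omega)

lemma tog_degree {α β μ : ℕ →₀ ℕ} (k : ℕ) (h1 : Il μ α) (h2 : Il μ β) :
    (tog α β k μ).degree + μ.degree = k + α.degree + β.degree := by
  obtain ⟨n, hn⟩ := exists_bound α
  obtain ⟨m, hm⟩ := exists_bound β
  obtain ⟨r, hr⟩ := exists_bound (tog α β k μ)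
  set N := n + m + r
  rw [degree_eq (tog α β k μ) (N + 1) (fun i hi => hr i (by omega)),
    degree_eq μ N (fun i hi => by have := (h1 i).1; rw [hn i (by omega)] at this; omega),
    degree_eq α (N + 1) (fun i hi => hn i (by omega)),
    degree_eq β (N + 1) (fun i hi => hm i (by omega)), Finset.sum_range_succ', tog_zero]
  have e : ∀ i, tog α β k μ (i+1) + μ i =
      max (α (i + 1)) (β (i + 1)) + min (α i) (β i) := by
    intro i
    have a1 := h1 i; have a2 := h2 i
    rw [tog_succ]; omega
  have e2 : ∑ i ∈ Finset.range N, tog α β k μ (i+1) + ∑ i ∈ Finset.range N, μ i =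
      ∑ i ∈ Finset.range N, max (α (i + 1)) (β (i + 1)) +
      ∑ i ∈ Finset.range N, min (α i) (β i) := by
    rw [← Finset.sum_add_distrib, ← Finset.sum_add_distrib]
    exact Finset.sum_congr rfl fun i _ => e i
  have e3 : ∑ i ∈ Finset.range (N+1), α i + ∑ i ∈ Finset.range (N+1), β i =
     ∑ i ∈ Finset.range (N+1), max (α i) (β i) + ∑ i ∈ Finset.range (N+1), min (α i) (β i) := by
    rw [← Finset.sum_add_distrib, ← Finset.sum_add_distrib]
    exact Finset.sum_congr rfl fun i _ => by omega
  rw [Finset.sum_range_succ' (fun i => max (α i) (β i)),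
    Finset.sum_range_succ (fun i => min (α i) (β i)), hn N (by omega)] at e3
  simp only [Nat.zero_min] at e3
  omega

lemma comm (x y : ENNReal) (α β : ℕ →₀ ℕ) :
    ∑' l, T x α l * T y β l = (1 - x * y)⁻¹ * ∑' μ, T y μ α * T x μ β := by
  rw [← ENNReal.tsum_geometric, ← ENNReal.tsum_mul_right]
  simp_rw [← ENNReal.tsum_mul_left]
  rw [← ENNReal.tsum_prod (f := fun k μ => (x * y) ^ k * (T y μ α * T x μ β))]
  have supp : ∀ p : Function.support (fun p : ℕ × (ℕ →₀ ℕ) =>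
      (x * y) ^ p.1 * (T y p.2 α * T x p.2 β)), Il p.1.2 α ∧ Il p.1.2 β := by
    rintro ⟨p, hp⟩
    constructor <;> by_contra hc <;> apply hp <;> simp [T, hc]
  apply tsum_eq_tsum_of_ne_zero_bij (fun p => tog α β p.1.1 p.1.2)
  · intro p p' h
    have h1 := supp p
    have h2 := supp p'
    obtain ⟨⟨k, μ⟩, hp⟩ := p
    obtain ⟨⟨k', μ'⟩, hp'⟩ := p'
    simp only at h1 h2 h
    have hk : k = k' := by
      have := DFunLike.congr_fun h 0
      simp only [tog_zero] at this
      omega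
    have hμ : μ = μ' := by
      ext i
      have := DFunLike.congr_fun h (i + 1)
      simp only [tog_succ] at this
      have a1 := h1.1 i; have a2 := h1.2 i; have a3 := h2.1 i; have a4 := h2.2 i
      omega
    subst hk hμ
    rfl
  · intro l hl
    have h : Il α l ∧ Il β l := by
      constructor <;> by_contra hc <;> apply hl <;> simp [T, hc]
    have hf : (Function.support (fun i => max (α (i+1)) (β (i+1)) + min (α i) (β i) - l (i+1))).Finite := by
      obtain ⟨n, hn⟩ := exists_bound α
      obtain ⟨m, hm⟩ := exists_bound β
      apply (Finset.finite_toSet (Finset.range (n + m + 1))).subset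
      intro i hi
      by_contra hc
      simp at hc
      apply hi
      simp [hn i (by omega), hn (i+1) (by omega), hm i (by omega), hm (i+1) (by omega)]
    set μ : ℕ →₀ ℕ := Finsupp.ofSupportFinite _ hf with hμ
    have hμi : ∀ i, μ i = max (α (i+1)) (β (i+1)) + min (α i) (β i) - l (i+1) := fun i => rfl
    have i1 : Il μ α := by
      intro i
      have a1 := h.1 i; have a2 := h.2 i; have a3 := h.1 (i+1); have a4 := h.2 (i+1)
      rw [hμi]; omega
    have i2 : Il μ β := by
      intro i
      have a1 := h.1 i; have a2 := h.2 i; have a3 := h.1 (i+1); have a4 := h.2 (i+1)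
      rw [hμi]; omega
    have hl' : tog α β (l 0 - max (α 0) (β 0)) μ = l := by
      ext i
      have a1 := h.1 i; have a2 := h.2 i
      cases i with
      | zero => rw [tog_zero]; omega
      | succ j =>
        have a3 := h.1 j; have a4 := h.2 j
        rw [tog_succ, hμi]; omega
    refine ⟨⟨(l 0 - max (α 0) (β 0), μ), ?_⟩, hl'⟩
    have hd := tog_degree (l 0 - max (α 0) (β 0)) i1 i2
    rw [hl'] at hd
    have d1 := i1.degree_le
    have d2 := i2.degree_le
    simp only [Function.mem_support, T, h, if_true, i1, i2] at hl ⊢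
    intro h0
    apply hl
    have e1 : l.degree - α.degree = (l 0 - max (α 0) (β 0)) + (β.degree - μ.degree) := by omega
    have e2 : l.degree - β.degree = (l 0 - max (α 0) (β 0)) + (α.degree - μ.degree) := by omega
    rw [e1, e2, ← h0, pow_add, pow_add, mul_pow]
    ring
  · intro p
    have h1 := supp p
    obtain ⟨⟨k, μ⟩, hp⟩ := p
    simp only at h1 ⊢
    obtain ⟨i1, i2⟩ := h1
    have hd := tog_degree k i1 i2
    have d1 := i1.degree_le
    have d2 := i2.degree_le
    have h := tog_il k i1 i2
    simp only [T, h, if_true, i1, i2]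
    have e1 : (tog α β k μ).degree - α.degree = k + (β.degree - μ.degree) := by omega
    have e2 : (tog α β k μ).degree - β.degree = k + (α.degree - μ.degree) := by omega
    rw [e1, e2, pow_add, pow_add, mul_pow]
    ring

open Classical in
/-- Schur function by branching. -/
def S : ℕ → (ℕ → ENNReal) → (ℕ →₀ ℕ) → ENNReal
  | 0, _, l => if l = 0 then 1 else 0
  | m + 1, X, l => ∑' μ, S m (fun i => X (i + 1)) μ * T (X 0) μ l

lemma il_zero {μ : ℕ →₀ ℕ} : Il μ 0 ↔ μ = 0 := by
  constructor
  · intro h; ext i; have := (h i).1; simpa using this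
  · rintro rfl i; simp

lemma T_zero (x : ENNReal) (μ : ℕ →₀ ℕ) : T x μ 0 = if μ = 0 then 1 else 0 := by
  unfold T
  simp only [il_zero]
  split_ifs with h <;> simp

lemma S_zero (m : ℕ) (X : ℕ → ENNReal) : S m X 0 = 1 := by
  induction m generalizing X with
  | zero => simp [S]
  | succ m ih => simp [S, T_zero, ih]

lemma S_skew (m : ℕ) (X : ℕ → ENNReal) (y : ENNReal) (β : ℕ →₀ ℕ) :
    ∑' l, S m X l * T y β l = (∏ i ∈ Finset.range m, (1 - X i * y)⁻¹) * S m X β := by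
  induction m generalizing X β with
  | zero => simp [S, T_zero]
  | succ m ih =>
    simp only [S]
    simp_rw [← ENNReal.tsum_mul_right]
    rw [ENNReal.tsum_comm]
    simp_rw [mul_assoc, ENNReal.tsum_mul_left, comm]
    simp_rw [← ENNReal.tsum_mul_left]
    rw [ENNReal.tsum_comm, Finset.prod_range_succ']
    apply tsum_congr
    intro μ
    have := ih (fun i => X (i+1)) μ
    calc _ = (1 - X 0 * y)⁻¹ * T (X 0) μ β * ∑' l, S m (fun i => X (i+1)) l * T y μ l := by
          rw [← ENNReal.tsum_mul_left]; apply tsum_congr; intro l; ring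
      _ = _ := by rw [this]; ring

lemma cauchy (m n : ℕ) (X Y : ℕ → ENNReal) :
    ∑' l, S m X l * S n Y l =
      ∏ i ∈ Finset.range m, ∏ j ∈ Finset.range n, (1 - X i * Y j)⁻¹ := by
  induction n generalizing Y with
  | zero => simp [S, S_zero]
  | succ n ih =>
    simp_rw [Finset.prod_range_succ' _ n]
    rw [Finset.prod_mul_distrib, ← ih (fun j => Y (j + 1))]
    simp only [S]
    simp_rw [← ENNReal.tsum_mul_left]
    rw [ENNReal.tsum_comm, ← ENNReal.tsum_mul_right]
    apply tsum_congr
    intro β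
    have := S_skew m X (Y 0) β
    calc _ = S n (fun j => Y (j+1)) β * ∑' l, S m X l * T (Y 0) β l := by
          rw [← ENNReal.tsum_mul_left]; apply tsum_congr; intro l; ring
      _ = _ := by rw [this]; ring

/-- chains of interlacing partitions ending at zero -/
def IsCh (m : ℕ) (L : ℕ → ℕ →₀ ℕ) : Prop := (∀ k, Il (L (k + 1)) (L k)) ∧ ∀ k, m ≤ k → L k = 0

lemma IsCh.le {m : ℕ} {L : ℕ → ℕ →₀ ℕ} (h : IsCh m L) (k i : ℕ) : L k i ≤ L (k + i) 0 := by
  induction i generalizing k with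
  | zero => simp
  | succ i ih =>
    have h1 := (h.1 k i).2
    have h2 := ih (k + 1)
    rw [show k + (i + 1) = k + 1 + i by ring]
    omega

lemma IsCh.zero {m : ℕ} {L : ℕ → ℕ →₀ ℕ} (h : IsCh m L) (k i : ℕ) (hk : m ≤ k + i) :
    L k i = 0 := by
  have h1 := h.le k i
  rw [h.2 _ hk] at h1
  simpa using h1

lemma IsCh.le0 {m : ℕ} {L : ℕ → ℕ →₀ ℕ} (h : IsCh m L) (k i : ℕ) : L k i ≤ L 0 i := by
  induction k with
  | zero => simp
  | succ k ih => exact ((h.1 k i).1).trans ih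

/-- chains starting at `l` -/
abbrev Ch (m : ℕ) (l : ℕ →₀ ℕ) := {L : ℕ → ℕ →₀ ℕ // IsCh m L ∧ L 0 = l}

def consSeq (l : ℕ →₀ ℕ) (L : ℕ → ℕ →₀ ℕ) : ℕ → ℕ →₀ ℕ
  | 0 => l
  | k + 1 => L k

def chMap (m : ℕ) (l : ℕ →₀ ℕ) (p : Σ μ : {μ : ℕ →₀ ℕ // Il μ l}, Ch m μ.1) : Ch (m + 1) l :=
  ⟨consSeq l p.2.1, ⟨⟨fun k => by
    cases k with
    | zero => simp only [consSeq]; rw [p.2.2.2]; exact p.1.2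
    | succ k => exact p.2.2.1.1 k, fun k hk => by
    cases k with
    | zero => omega
    | succ k => exact p.2.2.1.2 k (by omega)⟩, rfl⟩⟩

lemma chMap_bij (m : ℕ) (l : ℕ →₀ ℕ) : Function.Bijective (chMap m l) := by
  constructor
  · rintro ⟨⟨μ, hμ⟩, ⟨L, hL, h0⟩⟩ ⟨⟨μ', hμ'⟩, ⟨L', hL', h0'⟩⟩ h
    have h1 : L = L' := by
      funext k
      exact congrFun (congrArg Subtype.val h) (k + 1)
    subst h1
    simp only at h0 h0'
    subst h0
    subst h0'
    rfl
  · rintro ⟨L, hL, h0⟩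
    subst h0
    refine ⟨⟨⟨L 1, hL.1 0⟩, ⟨fun k => L (k + 1), ⟨fun k => hL.1 (k+1), fun k hk => hL.2 _ (by omega)⟩, rfl⟩⟩, ?_⟩
    apply Subtype.ext
    funext k
    cases k <;> rfl

def cw (m : ℕ) (Q c : ENNReal) (L : ℕ → ℕ →₀ ℕ) : ENNReal :=
  c ^ (L 0).degree * Q ^ (∑ k ∈ Finset.range m, (L (k + 1)).degree)

lemma ch_sum (m : ℕ) (Q c : ENNReal) (l : ℕ →₀ ℕ) :
    ∑' L : Ch m l, cw m Q c L.1 = S m (fun i => c * Q ^ i) l := by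
  induction m generalizing c l with
  | zero =>
    simp only [S]
    split_ifs with h
    · subst h
      rw [tsum_eq_single ⟨fun _ => 0, ⟨⟨fun k => il_zero.2 rfl, fun _ _ => rfl⟩, rfl⟩⟩]
      · simp [cw]
      · rintro ⟨L, hL, h0⟩ hne
        exact absurd (Subtype.ext (funext fun k => hL.2 k (Nat.zero_le _))) hne
    · have : IsEmpty (Ch 0 l) := ⟨fun L => h (by rw [← L.2.2, L.2.1.2 0 le_rfl])⟩
      simp
  | succ m ih =>
    rw [← (Equiv.ofBijective _ (chMap_bij m l)).tsum_eq, ENNReal.tsum_sigma']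
    simp only [S]
    have e : (fun i => c * Q ^ (i + 1)) = fun i => (c * Q) * Q ^ i := by
      funext i; ring
    rw [e]
    simp_rw [← ih]
    have : ∀ μ : {μ : ℕ →₀ ℕ // Il μ l}, ∑' L : Ch m μ.1,
        cw (m + 1) Q c ((Equiv.ofBijective _ (chMap_bij m l)) ⟨μ, L⟩).1 =
        (fun μ => (∑' L : Ch m μ, cw m Q (c * Q) L.1) * T c μ l) μ.1 := by
      rintro ⟨μ, hμ⟩
      simp only
      rw [← ENNReal.tsum_mul_right]
      apply tsum_congr
      rintro ⟨L, hL, h0⟩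
      have hd := hμ.degree_le
      simp only [cw, Equiv.ofBijective_apply, chMap, consSeq, T, hμ, if_true]
      subst h0
      rw [Finset.sum_range_succ', pow_add, mul_pow]
      calc _ = c ^ ((L 0).degree + (l.degree - (L 0).degree)) *
          (Q ^ (∑ k ∈ Finset.range m, (L (k + 1)).degree) * Q ^ (L 0).degree) := by
            rw [Nat.add_sub_cancel' hd]
        _ = _ := by rw [pow_add]; ring
    refine (tsum_congr this).trans ((tsum_subtype {μ | Il μ l}
      (fun μ => (∑' L : Ch m μ, cw m Q (c * Q) L.1) * T c μ l)).trans ?_)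
    rw [pow_zero, mul_one]
    apply tsum_congr
    intro μ
    simp only [Set.indicator]
    split_ifs with h
    · rfl
    · have h' : ¬ Il μ l := h
      simp [T, h']

/-- gluing two chains -/
def glue (m n : ℕ) (p : Σ l : ℕ →₀ ℕ, Ch m l × Ch n l) : PlanePartition m n where
  part i j := if j ≤ i then p.2.1.1 (i - j) j else p.2.2.1 (j - i) i
  antitone_fst i j := by
    obtain ⟨l, ⟨L, hL, h0⟩, ⟨R, hR, h0'⟩⟩ := p
    simp only
    split_ifs with h1 h2 h2
    · rw [show i + 1 - j = (i - j) + 1 by omega]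
      exact (hL.1 _ _).1
    · obtain rfl : j = i + 1 := by omega
      rw [show i + 1 - (i + 1) = 0 by omega, show i + 1 - i = 0 + 1 by omega, h0, ← h0']
      exact (hR.1 _ _).2
    · omega
    · rw [show j - i = (j - (i + 1)) + 1 by omega]
      exact (hR.1 _ _).2
  antitone_snd i j := by
    obtain ⟨l, ⟨L, hL, h0⟩, ⟨R, hR, h0'⟩⟩ := p
    simp only
    split_ifs with h1 h2 h2
    · rw [show i - j = (i - (j + 1)) + 1 by omega]
      exact (hL.1 _ _).2
    · omega
    · obtain rfl : j = i := by omega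
      rw [show j - j = 0 by omega, show j + 1 - j = 0 + 1 by omega, h0, ← h0']
      exact (hR.1 _ _).1
    · rw [show j + 1 - i = (j - i) + 1 by omega]
      exact (hR.1 _ _).1
  supp_fst i j hi := by
    have hi : m ≤ i := by exact_mod_cast hi
    obtain ⟨l, ⟨L, hL, h0⟩, ⟨R, hR, h0'⟩⟩ := p
    simp only
    split_ifs with h1
    · exact hL.zero _ _ (by omega)
    · have a := hR.le0 (j - i) i
      rw [h0', ← h0, hL.zero 0 i (by omega)] at a
      omega
  supp_snd i j hj := by
    have hj : n ≤ j := by exact_mod_cast hj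
    obtain ⟨l, ⟨L, hL, h0⟩, ⟨R, hR, h0'⟩⟩ := p
    simp only
    split_ifs with h1
    · have a := hL.le0 (i - j) j
      rw [h0, ← h0', hR.zero 0 j (by omega)] at a
      omega
    · exact hR.zero _ _ (by omega)
  finite_supp := by
    obtain ⟨l, ⟨L, hL, h0⟩, ⟨R, hR, h0'⟩⟩ := p
    apply (Finset.finite_toSet (Finset.range (m + n) ×ˢ Finset.range (m + n))).subset
    rintro ⟨i, j⟩ hij
    by_contra hc
    apply hij
    simp at hc
    simp only
    by_cases hi : i < m + n
    · have := hc hi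
      split_ifs with h1
      · exact hL.zero _ _ (by omega)
      · exact hR.zero _ _ (by omega)
    · split_ifs with h1
      · exact hL.zero _ _ (by omega)
      · exact hR.zero _ _ (by omega)

lemma part_ext {M N : ℕ∞} {Λ Λ' : PlanePartition M N} (h : Λ.part = Λ'.part) : Λ = Λ' := by
  cases Λ; cases Λ'; simp only at h; subst h; rfl

lemma glue_L {m n : ℕ} (p : Σ l : ℕ →₀ ℕ, Ch m l × Ch n l) (k i : ℕ) :
    (glue m n p).part (i + k) i = p.2.1.1 k i := by
  simp [glue]

lemma glue_R {m n : ℕ} (p : Σ l : ℕ →₀ ℕ, Ch m l × Ch n l) (k i : ℕ) :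
    (glue m n p).part i (i + k) = p.2.2.1 k i := by
  simp only [glue]
  split_ifs with h
  · obtain rfl : k = 0 := by omega
    simp [p.2.1.2.2, p.2.2.2.2]
  · simp

lemma fin_of (m : ℕ) (f : ℕ → ℕ) (h : ∀ i, m ≤ i → f i = 0) : (Function.support f).Finite := by
  apply (Finset.finite_toSet (Finset.range m)).subset
  intro i hi
  by_contra hc
  exact hi (h i (by simpa using hc))

lemma glue_bij (m n : ℕ) : Function.Bijective (glue m n) := by
  constructor
  · intro p p' h
    have hL : p.2.1.1 = p'.2.1.1 := by
      funext k; ext i; rw [← glue_L, ← glue_L, h]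
    have hR : p.2.2.1 = p'.2.2.1 := by
      funext k; ext i; rw [← glue_R, ← glue_R, h]
    obtain ⟨l, ⟨L, hL, h0⟩, ⟨R, hR, h0'⟩⟩ := p
    obtain ⟨l', ⟨L', hL', h0''⟩, ⟨R', hR', h0'''⟩⟩ := p'
    simp only at *
    subst hL
    subst hR
    subst h0
    subst h0''
    rfl
  · intro Λ
    have fL : ∀ k, (Function.support fun i => Λ.part (i + k) i).Finite := fun k =>
      fin_of m _ fun i hi => Λ.supp_fst _ _ (by exact_mod_cast (by omega : m ≤ i + k))
    have fR : ∀ k, (Function.support fun i => Λ.part i (i + k)).Finite := fun k =>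
      fin_of n _ fun i hi => Λ.supp_snd _ _ (by exact_mod_cast (by omega : n ≤ i + k))
    let L : ℕ → ℕ →₀ ℕ := fun k => Finsupp.ofSupportFinite _ (fL k)
    let R : ℕ → ℕ →₀ ℕ := fun k => Finsupp.ofSupportFinite _ (fR k)
    have Lk : ∀ k i, L k i = Λ.part (i + k) i := fun _ _ => rfl
    have Rk : ∀ k i, R k i = Λ.part i (i + k) := fun _ _ => rfl
    have hL : IsCh m L := by
      constructor
      · intro k i
        rw [Lk, Lk, Lk]
        refine ⟨Λ.antitone_fst (i + k) i, ?_⟩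
        rw [show i + 1 + k = i + (k + 1) by ring]
        exact Λ.antitone_snd _ _
      · intro k hk
        ext i
        rw [Lk]
        exact Λ.supp_fst _ _ (by exact_mod_cast (by omega : m ≤ i + k))
    have hR : IsCh n R := by
      constructor
      · intro k i
        rw [Rk, Rk, Rk]
        refine ⟨Λ.antitone_snd i (i + k), ?_⟩
        rw [show i + 1 + k = i + (k + 1) by ring]
        exact Λ.antitone_fst _ _
      · intro k hk
        ext i
        rw [Rk]
        exact Λ.supp_snd _ _ (by exact_mod_cast (by omega : n ≤ i + k))
    refine ⟨⟨L 0, ⟨L, hL, rfl⟩, ⟨R, hR, rfl⟩⟩, ?_⟩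
    apply part_ext
    funext i j
    rcases le_total j i with h | h
    · obtain ⟨k, rfl⟩ := Nat.exists_eq_add_of_le h
      rw [glue_L]; rfl
    · obtain ⟨k, rfl⟩ := Nat.exists_eq_add_of_le h
      rw [glue_R]; rfl

lemma finsum_aux (m : ℕ) (f : ℕ × ℕ → ℕ) (e : ℕ × ℕ → ℕ × ℕ) (he : Function.Injective e)
    (L : ℕ → ℕ →₀ ℕ) (hL : IsCh m L) (hf : ∀ k i, f (e (k, i)) = L (k + 1) i)
    (hs : ∀ p, f p ≠ 0 → ∃ k, e k = p) :
    ∑ᶠ p, f p = ∑ k ∈ Finset.range m, (L (k + 1)).degree := by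
  rw [finsum_eq_sum_of_support_subset (s := (Finset.range m ×ˢ Finset.range m).image e),
    Finset.sum_image he.injOn, Finset.sum_product]
  · apply Finset.sum_congr rfl
    intro k _
    rw [degree_eq (L (k+1)) m (fun i hi => hL.zero _ _ (by omega))]
    exact Finset.sum_congr rfl fun i _ => hf k i
  · intro p hp
    obtain ⟨⟨k, i⟩, rfl⟩ := hs p hp
    have h1 : L (k + 1) i ≠ 0 := by rw [← hf]; exact hp
    have h2 : ¬ (m ≤ k + 1 + i) := fun h => h1 (hL.zero _ _ h)
    simp only [Finset.coe_image, Finset.coe_product, Finset.coe_range]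
    exact ⟨(k, i), ⟨by simp; omega, by simp; omega⟩, rfl⟩

lemma glue_left {m n : ℕ} (p : Σ l : ℕ →₀ ℕ, Ch m l × Ch n l) :
    (glue m n p).leftVol = ∑ k ∈ Finset.range m, (p.2.1.1 (k + 1)).degree := by
  apply finsum_aux m _ (fun q => (q.2 + (q.1 + 1), q.2)) _ _ p.2.1.2.1
  · intro k i
    simp only
    rw [if_pos (by omega), glue_L]
  · rintro ⟨i, j⟩ h
    simp only [ne_eq, ite_eq_right_iff, Classical.not_imp] at h
    exact ⟨(i - j - 1, j), by ext <;> simp; omega⟩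
  · rintro ⟨a, b⟩ ⟨c, d⟩ h
    simp at h ⊢
    omega

lemma glue_right {m n : ℕ} (p : Σ l : ℕ →₀ ℕ, Ch m l × Ch n l) :
    (glue m n p).rightVol = ∑ k ∈ Finset.range n, (p.2.2.1 (k + 1)).degree := by
  apply finsum_aux n _ (fun q => (q.2, q.2 + (q.1 + 1))) _ _ p.2.2.2.1
  · intro k i
    simp only
    rw [if_pos (by omega), glue_R]
  · rintro ⟨i, j⟩ h
    simp only [ne_eq, ite_eq_right_iff, Classical.not_imp] at h
    exact ⟨(j - i - 1, i), by ext <;> simp; omega⟩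
  · rintro ⟨a, b⟩ ⟨c, d⟩ h
    simp at h ⊢
    omega

lemma glue_central {m n : ℕ} (p : Σ l : ℕ →₀ ℕ, Ch m l × Ch n l) :
    (glue m n p).centralVol = p.1.degree := by
  have h : ∀ i, (glue m n p).part i i = p.1 i := by
    intro i
    have := glue_L p 0 i
    rw [p.2.1.2.2] at this
    exact this
  unfold PlanePartition.centralVol
  simp_rw [h]
  rw [Finsupp.degree_apply, finsum_eq_sum_of_support_subset (s := p.1.support)]
  simp

def ew (Q R c : ENNReal) {M N : ℕ∞} (Λ : PlanePartition M N) : ENNReal :=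
  Q ^ Λ.leftVol * c ^ Λ.centralVol * R ^ Λ.rightVol

lemma pp_sum (m n : ℕ) (Q R c : ENNReal) :
    ∑' Λ : PlanePartition m n, ew Q R c Λ =
      ∏ i ∈ Finset.range m, ∏ j ∈ Finset.range n, (1 - c * Q ^ i * R ^ j)⁻¹ := by
  have := cauchy m n (fun i => c * Q ^ i) (fun j => 1 * R ^ j)
  simp only [one_mul] at this
  rw [← this, ← (Equiv.ofBijective _ (glue_bij m n)).tsum_eq, ENNReal.tsum_sigma']
  apply tsum_congr
  intro l
  have h2 := ch_sum n R 1 l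
  simp only [one_mul] at h2
  rw [← ch_sum, ← h2, ENNReal.tsum_prod', ← ENNReal.tsum_mul_right]
  apply tsum_congr
  intro L
  rw [← ENNReal.tsum_mul_left]
  apply tsum_congr
  intro K
  simp only [Equiv.ofBijective_apply, ew, glue_left, glue_right, glue_central, cw, one_pow, one_mul,
    L.2.2]
  ring

/-- inclusion -/
def incl {M N M' N' : ℕ∞} (hM : M ≤ M') (hN : N ≤ N') (Λ : PlanePartition M N) :
    PlanePartition M' N' :=
  ⟨Λ.part, Λ.antitone_fst, Λ.antitone_snd, fun i j h => Λ.supp_fst i j (hM.trans h),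
    fun i j h => Λ.supp_snd i j (hN.trans h), Λ.finite_supp⟩

lemma incl_inj {M N M' N' : ℕ∞} (hM : M ≤ M') (hN : N ≤ N') :
    Function.Injective (incl hM hN) := by
  intro Λ Λ' h
  apply part_ext
  have := congrArg PlanePartition.part h
  exact this

lemma pp_bound {M N : ℕ∞} (Λ : PlanePartition M N) :
    ∃ K : ℕ, ∀ i j, Λ.part i j ≠ 0 → i < K ∧ j < K := by
  obtain ⟨K, hK⟩ := (Λ.finite_supp.image (fun p => p.1 + p.2)).bddAbove
  refine ⟨K + 1, fun i j h => ?_⟩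
  have : i + j ≤ K := hK ⟨(i, j), h, rfl⟩
  omega

abbrev Ix (M N : ℕ∞) := {p : ℕ × ℕ // (p.1 : ℕ∞) < M ∧ (p.2 : ℕ∞) < N}

lemma toNat_min (M : ℕ∞) (K : ℕ) : ∃ m : ℕ, (m : ℕ∞) = min M K := by
  have : min M (K : ℕ∞) ≠ ⊤ := ne_top_of_le_ne_top (ENat.coe_ne_top K) (min_le_right _ _)
  exact ⟨_, ENat.coe_toNat this⟩

lemma box_prod {M N : ℕ∞} (f : ℕ × ℕ → ENNReal) (m n : ℕ) (hm : (m : ℕ∞) ≤ M) (hn : (n : ℕ∞) ≤ N) :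
    ∃ B : Finset (Ix M N), (∀ p : Ix M N, p.1.1 < m → p.1.2 < n → p ∈ B) ∧
      ∏ p ∈ B, f p.1 = ∏ i ∈ Finset.range m, ∏ j ∈ Finset.range n, f (i, j) := by
  classical
  refine ⟨(Finset.range m ×ˢ Finset.range n).subtype _, ?_, ?_⟩
  · intro p h1 h2
    simp [h1, h2]
  · rw [Finset.prod_subtype_of_mem, Finset.prod_product]
    rintro ⟨i, j⟩ h
    simp only [Finset.mem_product, Finset.mem_range] at h
    exact ⟨lt_of_lt_of_le (by exact_mod_cast h.1) hm, lt_of_lt_of_le (by exact_mod_cast h.2) hn⟩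

lemma upper {M N : ℕ∞} (Q R c : ENNReal) (t : Finset (PlanePartition M N)) :
    ∃ B : Finset (Ix M N), ∑ Λ ∈ t, ew Q R c Λ ≤ ∏ p ∈ B, (1 - c * Q ^ p.1.1 * R ^ p.1.2)⁻¹ := by
  choose K hK using pp_bound (M := M) (N := N)
  set k := t.sup K with hk
  obtain ⟨m, hm⟩ := toNat_min M k
  obtain ⟨n, hn⟩ := toNat_min N k
  have hm' : (m : ℕ∞) ≤ M := hm ▸ min_le_left _ _
  have hn' : (n : ℕ∞) ≤ N := hn ▸ min_le_left _ _
  obtain ⟨B, -, hB⟩ := box_prod (fun p => (1 - c * Q ^ p.1 * R ^ p.2)⁻¹) m n hm' hn'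
  refine ⟨B, ?_⟩
  rw [hB, ← pp_sum, ← Finset.sum_preimage (incl hm' hn') t (incl_inj hm' hn').injOn]
  · exact ENNReal.sum_le_tsum (f := fun Λ : PlanePartition m n => ew Q R c Λ) _
  · intro Λ hΛ hr
    exfalso
    apply hr
    have hle : K Λ ≤ k := Finset.le_sup hΛ
    refine ⟨⟨Λ.part, Λ.antitone_fst, Λ.antitone_snd, fun i j h => ?_, fun i j h => ?_,
      Λ.finite_supp⟩, rfl⟩
    · by_contra hc
      have h1 := (hK Λ i j hc).1
      rw [hm, min_le_iff] at h
      rcases h with h | h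
      · exact hc (Λ.supp_fst i j h)
      · have : k ≤ i := by exact_mod_cast h
        omega
    · by_contra hc
      have h1 := (hK Λ i j hc).2
      rw [hn, min_le_iff] at h
      rcases h with h | h
      · exact hc (Λ.supp_snd i j h)
      · have : k ≤ j := by exact_mod_cast h
        omega

lemma lower {M N : ℕ∞} (Q R c : ENNReal) (s : Finset (Ix M N)) :
    ∏ p ∈ s, (1 - c * Q ^ p.1.1 * R ^ p.1.2)⁻¹ ≤ ∑' Λ : PlanePartition M N, ew Q R c Λ := by
  set k := s.sup (fun p => p.1.1 + p.1.2 + 1) with hk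
  obtain ⟨m, hm⟩ := toNat_min M k
  obtain ⟨n, hn⟩ := toNat_min N k
  have hm' : (m : ℕ∞) ≤ M := hm ▸ min_le_left _ _
  have hn' : (n : ℕ∞) ≤ N := hn ▸ min_le_left _ _
  obtain ⟨B, hB1, hB⟩ := box_prod (fun p => (1 - c * Q ^ p.1 * R ^ p.2)⁻¹) m n hm' hn'
  have hs : s ⊆ B := by
    intro p hp
    have hle : p.1.1 + p.1.2 + 1 ≤ k := Finset.le_sup (f := fun p : Ix M N => p.1.1 + p.1.2 + 1) hp
    apply hB1
    · have : (p.1.1 : ℕ∞) < m := by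
        rw [hm, lt_min_iff]
        exact ⟨p.2.1, by exact_mod_cast (by omega)⟩
      exact_mod_cast this
    · have : (p.1.2 : ℕ∞) < n := by
        rw [hn, lt_min_iff]
        exact ⟨p.2.2, by exact_mod_cast (by omega)⟩
      exact_mod_cast this
  calc _ ≤ ∏ p ∈ B, (1 - c * Q ^ p.1.1 * R ^ p.1.2)⁻¹ :=
        Finset.prod_le_prod_of_subset_of_one_le' hs fun p _ _ => by
          rw [ENNReal.one_le_inv]; exact tsub_le_self
    _ = ∑' Λ : PlanePartition m n, ew Q R c Λ := by rw [hB, pp_sum]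
    _ = ∑' Λ : PlanePartition m n, ew Q R c (incl hm' hn' Λ) := rfl
    _ ≤ _ := ENNReal.tsum_comp_le_tsum_of_injective (incl_inj hm' hn') _

lemma final {M N : ℕ∞} (Q R c : ℝ) (hQ : 0 < Q) (hQ1 : Q < 1) (hR : 0 < R) (hR1 : R < 1)
    (hc : 0 < c) (hc1 : c < 1) :
    Multipliable (fun p : Ix M N => (1 - c * Q ^ p.1.1 * R ^ p.1.2)⁻¹) ∧
    HasSum (fun Λ : PlanePartition M N => Q ^ Λ.leftVol * c ^ Λ.centralVol * R ^ Λ.rightVol)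
      (∏' p : Ix M N, (1 - c * Q ^ p.1.1 * R ^ p.1.2)⁻¹) := by
  have x0 : ∀ i j : ℕ, 0 < c * Q ^ i * R ^ j := fun i j => by positivity
  have x1 : ∀ i j : ℕ, c * Q ^ i * R ^ j ≤ c := fun i j => by
    have h1 : Q ^ i ≤ 1 := pow_le_one₀ hQ.le hQ1.le
    have h2 : R ^ j ≤ 1 := pow_le_one₀ hR.le hR1.le
    have h3 : Q ^ i * R ^ j ≤ 1 := mul_le_one₀ h1 (by positivity) h2
    rw [mul_assoc]
    exact mul_le_of_le_one_right hc.le h3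
  have hsm : Summable (fun p : ℕ × ℕ => (1 - c)⁻¹ * (c * (Q ^ p.1 * R ^ p.2))) := by
    apply Summable.mul_left
    apply Summable.mul_left
    exact (summable_geometric_of_lt_one hQ.le hQ1).mul_of_nonneg
      (summable_geometric_of_lt_one hR.le hR1) (fun i => by positivity) (fun i => by positivity)
  have hmul : Multipliable (fun p : Ix M N => (1 - c * Q ^ p.1.1 * R ^ p.1.2)⁻¹) := by
    have h1 : Summable (fun p : Ix M N => (1 - c * Q ^ p.1.1 * R ^ p.1.2)⁻¹ - 1) := by
      refine Summable.of_nonneg_of_le ?_ ?_ (hsm.subtype _)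
      · rintro ⟨⟨i, j⟩, h⟩
        simp only [sub_nonneg]
        exact (one_le_inv₀ (by linarith [x1 i j])).2 (by linarith [x0 i j])
      · rintro ⟨⟨i, j⟩, h⟩
        have h0 := x0 i j
        have h1 := x1 i j
        simp only [Function.comp]
        have e : (1 - c * Q ^ i * R ^ j)⁻¹ - 1 = (1 - c * Q ^ i * R ^ j)⁻¹ * (c * (Q ^ i * R ^ j)) := by
          have : 1 - c * Q ^ i * R ^ j ≠ 0 := by linarith
          field_simp
          ring
        rw [e]
        gcongr
    have := Real.multipliable_one_add_of_summable h1
    simpa using this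
  refine ⟨hmul, ?_⟩
  set P := ∏' p : Ix M N, (1 - c * Q ^ p.1.1 * R ^ p.1.2)⁻¹ with hP
  have hprod := hmul.hasProd
  rw [← hP] at hprod
  have conv : ∀ s : Finset (Ix M N), ENNReal.ofReal (∏ p ∈ s, (1 - c * Q ^ p.1.1 * R ^ p.1.2)⁻¹) =
      ∏ p ∈ s, (1 - ENNReal.ofReal c * ENNReal.ofReal Q ^ p.1.1 * ENNReal.ofReal R ^ p.1.2)⁻¹ := by
    intro s
    rw [ENNReal.ofReal_prod_of_nonneg]
    · apply Finset.prod_congr rfl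
      rintro ⟨⟨i, j⟩, h⟩ _
      simp only
      rw [ENNReal.ofReal_inv_of_pos (by linarith [x1 i j]), ENNReal.ofReal_sub _ (x0 i j).le,
        ENNReal.ofReal_mul (by positivity), ENNReal.ofReal_mul hc.le, ENNReal.ofReal_pow hQ.le,
        ENNReal.ofReal_pow hR.le, ENNReal.ofReal_one]
    · rintro ⟨⟨i, j⟩, h⟩ _
      exact inv_nonneg.2 (by linarith [x1 i j])
  have hlim : Tendsto (fun s : Finset (Ix M N) => ∏ p ∈ s, (1 - ENNReal.ofReal c *
      ENNReal.ofReal Q ^ p.1.1 * ENNReal.ofReal R ^ p.1.2)⁻¹) atTop (𝓝 (ENNReal.ofReal P)) := by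
    simp_rw [← conv]
    exact (ENNReal.continuous_ofReal.tendsto P).comp hprod
  have hw : ∀ Λ : PlanePartition M N,
      ENNReal.ofReal (Q ^ Λ.leftVol * c ^ Λ.centralVol * R ^ Λ.rightVol) =
      ew (ENNReal.ofReal Q) (ENNReal.ofReal R) (ENNReal.ofReal c) Λ := by
    intro Λ
    rw [ew, ENNReal.ofReal_mul (by positivity), ENNReal.ofReal_mul (by positivity),
      ENNReal.ofReal_pow hQ.le, ENNReal.ofReal_pow hR.le, ENNReal.ofReal_pow hc.le]
  have hmono : Monotone (fun s : Finset (Ix M N) => ∏ p ∈ s, (1 - ENNReal.ofReal c *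
      ENNReal.ofReal Q ^ p.1.1 * ENNReal.ofReal R ^ p.1.2)⁻¹) :=
    Finset.prod_mono_set_of_one_le' fun p => by
      rw [ENNReal.one_le_inv]; exact tsub_le_self
  have hsum : ∑' Λ : PlanePartition M N,
      ENNReal.ofReal (Q ^ Λ.leftVol * c ^ Λ.centralVol * R ^ Λ.rightVol) = ENNReal.ofReal P := by
    simp_rw [hw]
    apply le_antisymm
    · rw [ENNReal.tsum_eq_iSup_sum]
      apply iSup_le
      intro t
      obtain ⟨B, hB⟩ := upper (ENNReal.ofReal Q) (ENNReal.ofReal R) (ENNReal.ofReal c) t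
      exact hB.trans (hmono.ge_of_tendsto hlim B)
    · exact le_of_tendsto' hlim fun s => lower _ _ _ s
  have hP0 : 0 ≤ P := by
    apply ge_of_tendsto' hprod
    intro s
    apply Finset.prod_nonneg
    rintro ⟨⟨i, j⟩, h⟩ _
    exact inv_nonneg.2 (by linarith [x1 i j])
  have hnn : ∀ Λ : PlanePartition M N,
      0 ≤ Q ^ Λ.leftVol * c ^ Λ.centralVol * R ^ Λ.rightVol := fun Λ => by positivity
  have hs : Summable (fun Λ : PlanePartition M N =>
      Q ^ Λ.leftVol * c ^ Λ.centralVol * R ^ Λ.rightVol) := by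
    have h := ENNReal.summable_toReal (f := fun Λ : PlanePartition M N =>
      ENNReal.ofReal (Q ^ Λ.leftVol * c ^ Λ.centralVol * R ^ Λ.rightVol))
      (by rw [hsum]; exact ENNReal.ofReal_ne_top)
    simpa only [ENNReal.toReal_ofReal (hnn _)] using h
  rw [hs.hasSum_iff]
  rw [← ENNReal.ofReal_tsum_of_nonneg hnn hs] at hsum
  exact (ENNReal.ofReal_eq_ofReal_iff (tsum_nonneg hnn) hP0).1 hsum

end MBP

/-- the Muttalib–Borodin partition function of `(M,N)`-based plane partitions
converges and equals `∏_{1≤i≤M} ∏_{1≤j≤N} (1 - a Q^{i-1/2} Q̃^{j-1/2})⁻¹` (0-based indices). -/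
theorem statement0 (q a η θ : ℝ) (hq0 : 0 < q) (hq1 : q < 1) (ha0 : 0 < a) (ha1 : a ≤ 1)
    (hη : 0 < η) (hθ : 0 < θ) (M N : ℕ∞) (hM : 1 ≤ M) (hMN : M ≤ N) :
    Multipliable (fun p : {p : ℕ × ℕ // (p.1 : ℕ∞) < M ∧ (p.2 : ℕ∞) < N} =>
      (1 - a * (q ^ η) ^ ((p.1.1 : ℝ) + 1 / 2) * (q ^ θ) ^ ((p.1.2 : ℝ) + 1 / 2))⁻¹) ∧
    HasSum (fun Λ : PlanePartition M N => mbWeight q a η θ Λ)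
      (∏' p : {p : ℕ × ℕ // (p.1 : ℕ∞) < M ∧ (p.2 : ℕ∞) < N},
        (1 - a * (q ^ η) ^ ((p.1.1 : ℝ) + 1 / 2) * (q ^ θ) ^ ((p.1.2 : ℝ) + 1 / 2))⁻¹) := by
  have hQ : 0 < q ^ η := Real.rpow_pos_of_pos hq0 η
  have hR : 0 < q ^ θ := Real.rpow_pos_of_pos hq0 θ
  have hQ1 : q ^ η < 1 := Real.rpow_lt_one hq0.le hq1 hη
  have hR1 : q ^ θ < 1 := Real.rpow_lt_one hq0.le hq1 hθ
  have hc : 0 < a * Real.sqrt ((q ^ η) * (q ^ θ)) := mul_pos ha0 (Real.sqrt_pos.2 (mul_pos hQ hR))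
  have hc1 : a * Real.sqrt ((q ^ η) * (q ^ θ)) < 1 := by
    have h1 : Real.sqrt ((q ^ η) * (q ^ θ)) < 1 := by
      rw [Real.sqrt_lt' one_pos]
      nlinarith
    have h2 : 0 ≤ Real.sqrt ((q ^ η) * (q ^ θ)) := Real.sqrt_nonneg _
    nlinarith
  have key := MBP.final (M := M) (N := N) (q ^ η) (q ^ θ) _ hQ hQ1 hR hR1 hc hc1
  have e : (fun p : {p : ℕ × ℕ // (p.1 : ℕ∞) < M ∧ (p.2 : ℕ∞) < N} =>
      (1 - a * (q ^ η) ^ ((p.1.1 : ℝ) + 1 / 2) * (q ^ θ) ^ ((p.1.2 : ℝ) + 1 / 2))⁻¹) =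
      fun p => (1 - a * Real.sqrt ((q ^ η) * (q ^ θ)) * (q ^ η) ^ p.1.1 * (q ^ θ) ^ p.1.2)⁻¹ := by
    funext p
    rw [Real.rpow_add hQ, Real.rpow_add hR, Real.rpow_natCast, Real.rpow_natCast,
      Real.sqrt_mul hQ.le, Real.sqrt_eq_rpow, Real.sqrt_eq_rpow]
    congr 2
    ring
  rw [e]
  exact key

end
end

section
/- Fix integers 1≤M≤N (finite), reals 0<q<1, 0<a≤1, η,θ>0, Q=q^η, Q̃=q^θ, and let Λ be distributed according to the Muttalib–Borodin measure on (M,N)-based plane partitions. Then there is a constant C>0, independent of λ, such that for every partition λ=(λ_1≥λ_2≥⋯≥λ_M≥0), the probability that the central slice of Λ equals λ (i.e. Λ_{i,i}=λ_i for 1≤i≤M) equals C·∏_{1≤i<j≤M}(Q^{l_j}−Q^{l_i})(Q̃^{l_j}−Q̃^{l_i})·∏_{1≤i≤M}(a√(QQ̃))^{l_i}·(Q̃^{l_i+1};Q̃)_{N−M}, where l_i=λ_i+M−i. -/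
open MeasureTheory Filter Topology Set

noncomputable section



/-- Vandermonde-type product. -/
def mbV (Q : ℝ) (n : ℕ) (lam : Fin n → ℕ) : ℝ :=
  (Matrix.vandermonde fun i : Fin n => Q ^ (lam i + (n - 1 - (i : ℕ)))).det

/-- Generating function of triangular patterns. -/
def mbG (Q : ℝ) : (n : ℕ) → (Fin n → ℕ) → ℝ
  | 0, _ => 1
  | (n + 1), lam => ∑ mu ∈ Fintype.piFinset (fun i : Fin n => Finset.Icc (lam i.succ) (lam i.castSucc)),
      Q ^ (∑ i, mu i) * mbG Q n mu

lemma mb_det_step (n : ℕ) (x : Fin (n + 1) → ℝ) :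
    (Matrix.vandermonde x).det =
      (Matrix.of fun i j : Fin n => x i.succ ^ ((j : ℕ) + 1) - x i.castSucc ^ ((j : ℕ) + 1)).det := by
  rw [Matrix.det_eq_of_forall_row_eq_smul_add_pred (B := Matrix.of (Fin.cons (fun j => x 0 ^ (j : ℕ))
    (fun i : Fin n => fun j : Fin (n+1) => x i.succ ^ (j : ℕ) - x i.castSucc ^ (j : ℕ)))) (fun _ => 1)]
  · rw [Matrix.det_succ_column_zero, Fin.sum_univ_succ]
    simp only [Matrix.of_apply, Fin.cons_zero, Fin.cons_succ]
    simp
    congr 1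
  · intro j; simp [Matrix.vandermonde]
  · intro i j; simp [Matrix.vandermonde]

lemma mb_inner (Q : ℝ) (hQ0 : 0 < Q) (hQ1 : Q < 1) (a b s j : ℕ) (hab : a ≤ b) :
    ∑ m ∈ Finset.Icc a b, Q ^ m * (Q ^ (m + s)) ^ j =
      (Q ^ s)⁻¹ * ((1 - Q ^ (j + 1))⁻¹ * ((Q ^ (a + s)) ^ (j + 1) - (Q ^ (b + s + 1)) ^ (j + 1))) := by
  have h1 : (1 - Q ^ (j + 1)) ≠ 0 := by
    have := pow_lt_one₀ hQ0.le hQ1 (Nat.succ_ne_zero j)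
    simp only [Nat.succ_eq_add_one] at this
    linarith
  induction b, hab using Nat.le_induction with
  | base =>
    simp only [Finset.Icc_self, Finset.sum_singleton]
    field_simp
    ring
  | succ b hb ih =>
    rw [Finset.sum_Icc_succ_top (by omega), ih]
    field_simp
    ring

lemma mb_branch (Q : ℝ) (hQ0 : 0 < Q) (hQ1 : Q < 1) (n : ℕ) (lam : Fin (n + 1) → ℕ)
    (hl : Antitone lam) :
    ∑ mu ∈ Fintype.piFinset (fun i : Fin n => Finset.Icc (lam i.succ) (lam i.castSucc)),
      Q ^ (∑ i, mu i) * mbV Q n mu =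
    ((∏ i : Fin n, (Q ^ (n - 1 - (i : ℕ)))⁻¹) * ∏ j : Fin n, (1 - Q ^ ((j : ℕ) + 1))⁻¹)
      * mbV Q (n + 1) lam := by
  have h1 : ∀ mu : Fin n → ℕ, Q ^ (∑ i, mu i) * mbV Q n mu =
      Matrix.detRowAlternating (fun i : Fin n => (fun j : Fin n =>
        Q ^ (mu i) * (Q ^ (mu i + (n - 1 - (i : ℕ)))) ^ (j : ℕ))) := by
    intro mu
    rw [mbV, ← Finset.prod_pow_eq_pow_sum, ← Matrix.det_mul_column]
    rfl
  simp_rw [h1]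
  have h2 := (Matrix.detRowAlternating (R := ℝ) (n := Fin n)).toMultilinearMap.map_sum_finset
    (fun i (m : ℕ) => (fun j : Fin n => Q ^ m * (Q ^ (m + (n - 1 - (i : ℕ)))) ^ (j : ℕ)))
    (fun i : Fin n => Finset.Icc (lam i.succ) (lam i.castSucc))
  refine Eq.trans h2.symm ?_
  have h3 : (fun i : Fin n => ∑ m ∈ Finset.Icc (lam i.succ) (lam i.castSucc),
      (fun j : Fin n => Q ^ m * (Q ^ (m + (n - 1 - (i : ℕ)))) ^ (j : ℕ))) =
      Matrix.of fun i j : Fin n => (Q ^ (n - 1 - (i : ℕ)))⁻¹ *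
        (Matrix.of fun i j : Fin n => (1 - Q ^ ((j : ℕ) + 1))⁻¹ *
        (Matrix.of fun i j : Fin n => (Q ^ (lam i.succ + (n + 1 - 1 - (i.succ : ℕ)))) ^ ((j : ℕ) + 1)
          - (Q ^ (lam i.castSucc + (n + 1 - 1 - (i.castSucc : ℕ)))) ^ ((j : ℕ) + 1)) i j) i j := by
    ext i j
    simp only [Finset.sum_apply, Matrix.of_apply]
    rw [mb_inner Q hQ0 hQ1 _ _ _ _ (hl (Fin.castSucc_lt_succ).le)]
    have e1 : n + 1 - 1 - (i.succ : ℕ) = n - 1 - i := by simp; omega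
    have e2 : lam i.castSucc + (n + 1 - 1 - (i.castSucc : ℕ)) = lam i.castSucc + (n - 1 - i) + 1 := by
      have := i.2
      simp; omega
    rw [e1, e2]
  rw [mbV, mb_det_step, mul_assoc, ← Matrix.det_mul_row, ← Matrix.det_mul_column]
  exact congrArg Matrix.det h3

lemma mbG_eq (Q : ℝ) (hQ0 : 0 < Q) (hQ1 : Q < 1) (n : ℕ) :
    ∃ c : ℝ, 0 < c ∧ ∀ lam : Fin n → ℕ, Antitone lam → mbG Q n lam = c * mbV Q n lam := by
  induction n with
  | zero => exact ⟨1, one_pos, fun lam _ => by simp [mbG, mbV]⟩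
  | succ n ih =>
    obtain ⟨c, hc, h⟩ := ih
    refine ⟨c * ((∏ i : Fin n, (Q ^ (n - 1 - (i : ℕ)))⁻¹) * ∏ j : Fin n, (1 - Q ^ ((j : ℕ) + 1))⁻¹),
      ?_, ?_⟩
    · refine mul_pos hc (mul_pos (Finset.prod_pos fun i _ => by positivity)
        (Finset.prod_pos fun i _ => inv_pos.2 ?_))
      have := pow_lt_one₀ hQ0.le hQ1 (Nat.succ_ne_zero (i : ℕ))
      simp only [Nat.succ_eq_add_one] at this
      linarith
    · intro lam hl
      rw [mul_assoc, ← mb_branch Q hQ0 hQ1 n lam hl, mbG, Finset.mul_sum]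
      refine Finset.sum_congr rfl fun mu hmu => ?_
      rw [h mu]
      · ring
      · simp only [Fintype.mem_piFinset, Finset.mem_Icc] at hmu
        intro i j hij
        rcases hij.eq_or_lt with rfl | hij
        · rfl
        · exact ((hmu j).2.trans (hl (by
            rw [Fin.le_def]; simp; exact hij))).trans (hmu i).1

lemma mbV_eq (Q : ℝ) (n : ℕ) (lam : Fin n → ℕ) : mbV Q n lam =
    ∏ i : Fin n, ∏ j : Fin n, if i < j then
      Q ^ (lam j + (n - 1 - (j : ℕ))) - Q ^ (lam i + (n - 1 - (i : ℕ))) else 1 := by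
  rw [mbV, Matrix.det_vandermonde]
  refine Finset.prod_congr rfl fun i _ => ?_
  rw [← Finset.prod_filter]
  refine Finset.prod_congr ?_ fun _ _ => rfl
  ext; simp

def mbExt (M K : ℕ) (lam : Fin M → ℕ) : Fin (M + K) → ℕ :=
  Fin.append lam (fun _ => 0)

lemma mbV_ext (Q : ℝ) (hQ0 : 0 < Q) (hQ1 : Q < 1) (M K : ℕ) :
    ∃ c : ℝ, 0 < c ∧ ∀ lam : Fin M → ℕ, mbV Q (M + K) (mbExt M K lam) =
      c * (mbV Q M lam * ∏ i : Fin M, qPoch (Q ^ (lam i + (M - 1 - (i : ℕ)) + 1)) Q K) := by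
  refine ⟨(∏ i : Fin M, ∏ j : Fin M, if i < j then Q ^ K else 1) *
    (∏ i : Fin M, ∏ k : Fin K, Q ^ (K - 1 - (k : ℕ))) *
    ∏ i : Fin K, ∏ j : Fin K, if i < j then
      Q ^ (K - 1 - (j : ℕ)) - Q ^ (K - 1 - (i : ℕ)) else 1, ?_, ?_⟩
  · refine mul_pos (mul_pos ?_ ?_) ?_
    · exact Finset.prod_pos fun i _ => Finset.prod_pos fun j _ => by split_ifs <;> positivity
    · positivity
    · refine Finset.prod_pos fun i _ => Finset.prod_pos fun j _ => ?_
      split_ifs with h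
      · rw [sub_pos]
        have := j.2
        exact pow_lt_pow_right_of_lt_one₀ hQ0 hQ1 (by rw [Fin.lt_def] at h; omega)
      · exact one_pos
  · intro lam
    rw [mbV_eq, mbV_eq]
    simp only [Fin.prod_univ_add, mbExt, Fin.append_left, Fin.append_right]
    simp only [Finset.prod_mul_distrib]
    have b1 : ∀ i j : Fin M, (if Fin.castAdd K i < Fin.castAdd K j then
        Q ^ (lam j + (M + K - 1 - (Fin.castAdd K j : ℕ))) - Q ^ (lam i + (M + K - 1 - (Fin.castAdd K i : ℕ)))
        else 1) = (if i < j then Q ^ K else 1) * (if i < j then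
        Q ^ (lam j + (M - 1 - (j : ℕ))) - Q ^ (lam i + (M - 1 - (i : ℕ))) else 1) := by
      intro i j
      have := i.2; have := j.2
      have e1 : lam j + (M + K - 1 - (Fin.castAdd K j : ℕ)) = K + (lam j + (M - 1 - j)) := by
        simp; omega
      have e2 : lam i + (M + K - 1 - (Fin.castAdd K i : ℕ)) = K + (lam i + (M - 1 - i)) := by
        simp; omega
      rw [e1, e2, pow_add, pow_add]
      have e3 : (Fin.castAdd K i < Fin.castAdd K j) ↔ i < j := by rw [Fin.lt_def, Fin.lt_def]; rfl
      simp only [e3]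
      split_ifs <;> ring
    have b2 : ∀ (i : Fin M) (j : Fin K), (if Fin.castAdd K i < Fin.natAdd M j then
        Q ^ (0 + (M + K - 1 - (Fin.natAdd M j : ℕ))) - Q ^ (lam i + (M + K - 1 - (Fin.castAdd K i : ℕ)))
        else 1) = Q ^ (K - 1 - (j : ℕ)) * (1 - Q ^ (lam i + (M - 1 - (i : ℕ)) + 1) * Q ^ (j : ℕ)) := by
      intro i j
      have := i.2; have := j.2
      have e3 : (Fin.castAdd K i < Fin.natAdd M j) := by simp [Fin.lt_def]; omega
      rw [if_pos e3, mul_sub, mul_one, ← pow_add, ← pow_add]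
      congr 2
      · simp; omega
      · simp; omega
    have b3 : ∀ (i : Fin K) (j : Fin M), ¬ (Fin.natAdd M i < Fin.castAdd K j) := by
      intro i j
      have := j.2
      simp [Fin.lt_def]; omega
    have b4 : ∀ i j : Fin K, (if Fin.natAdd M i < Fin.natAdd M j then
        Q ^ (0 + (M + K - 1 - (Fin.natAdd M j : ℕ))) - Q ^ (0 + (M + K - 1 - (Fin.natAdd M i : ℕ)))
        else 1) = (if i < j then
        Q ^ (K - 1 - (j : ℕ)) - Q ^ (K - 1 - (i : ℕ)) else 1) := by
      intro i j
      have := i.2; have := j.2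
      have e1 : 0 + (M + K - 1 - (Fin.natAdd M j : ℕ)) = K - 1 - j := by
        simp; omega
      have e2 : 0 + (M + K - 1 - (Fin.natAdd M i : ℕ)) = K - 1 - i := by
        simp; omega
      have e3 : (Fin.natAdd M i < Fin.natAdd M j) ↔ i < j := by
        rw [Fin.lt_def, Fin.lt_def]; simp
      rw [e1, e2]
      simp only [e3]
    simp only [b1, b2, b3, b4, if_false, Finset.prod_const_one, one_mul, Finset.prod_mul_distrib,
      qPoch, Finset.prod_range]
    ring

/-- Triangular patterns with given diagonal. -/
structure MbTri (n : ℕ) (lam : Fin n → ℕ) (f : ℕ → ℕ → ℕ) : Prop where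
  diag : ∀ i (h : i < n), f i i = lam ⟨i, h⟩
  low : ∀ i j, j < i → f i j = 0
  high : ∀ i j, n ≤ j → f i j = 0
  snd : ∀ i j, i ≤ j → f i (j + 1) ≤ f i j
  fst : ∀ i j, i + 1 ≤ j → f (i + 1) j ≤ f i j

def mbAdd (n : ℕ) (lam : Fin (n + 1) → ℕ) (g : ℕ → ℕ → ℕ) : ℕ → ℕ → ℕ := fun i j =>
  if i = j then (if h : i < n + 1 then lam ⟨i, h⟩ else 0) else if i < j then g i (j - 1) else 0

open Classical in
def mbP : (n : ℕ) → (Fin n → ℕ) → Finset (ℕ → ℕ → ℕ)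
  | 0, _ => {fun _ _ => 0}
  | (n + 1), lam => (Fintype.piFinset
      (fun i : Fin n => Finset.Icc (lam i.succ) (lam i.castSucc))).biUnion
        fun mu => (mbP n mu).image (mbAdd n lam)

lemma mbP_mem (n : ℕ) : ∀ (lam : Fin n → ℕ) (f : ℕ → ℕ → ℕ), f ∈ mbP n lam ↔ MbTri n lam f := by
  induction n with
  | zero =>
    intro lam f
    simp only [mbP, Finset.mem_singleton]
    constructor
    · rintro rfl
      exact ⟨fun i h => by omega, fun _ _ _ => rfl, fun _ _ _ => rfl, fun _ _ _ => le_rfl,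
        fun _ _ _ => le_rfl⟩
    · intro h
      ext i j
      exact h.high i j (Nat.zero_le _)
  | succ n ih =>
    intro lam f
    simp only [mbP, Finset.mem_biUnion, Fintype.mem_piFinset, Finset.mem_Icc, Finset.mem_image]
    constructor
    · rintro ⟨mu, hmu, g, hg, rfl⟩
      rw [ih] at hg
      refine ⟨?_, ?_, ?_, ?_, ?_⟩
      · intro i h; simp [mbAdd, h]
      · intro i j h
        simp only [mbAdd]
        rw [if_neg (by omega), if_neg (by omega)]
      · intro i j h
        simp only [mbAdd]
        split_ifs with h1 h2 h3
        · omega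
        · rfl
        · exact hg.high _ _ (by omega)
        · rfl
      · intro i j h
        simp only [mbAdd]
        rw [if_neg (by omega), if_pos (by omega)]
        rcases h.eq_or_lt with rfl | h
        · rw [if_pos rfl]
          by_cases hi : i < n
          · rw [dif_pos (by omega)]
            have := (hmu ⟨i, hi⟩).2
            rw [Nat.add_sub_cancel, hg.diag i hi]
            exact this
          · rw [hg.high _ _ (by omega)]; exact Nat.zero_le _
        · rw [if_neg (by omega), if_pos h]
          have := hg.snd i (j - 1) (by omega)
          rwa [show j - 1 + 1 = j + 1 - 1 by omega] at this
      · intro i j h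
        simp only [mbAdd]
        rw [if_neg (show ¬ i = j by omega), if_pos (show i < j by omega)]
        rcases h.eq_or_lt with rfl | h
        · rw [if_pos rfl]
          split_ifs with hi
          · have := (hmu ⟨i, by omega⟩).1
            rw [Nat.add_sub_cancel, hg.diag i (by omega)]
            exact this
          · exact Nat.zero_le _
        · rw [if_neg (by omega), if_pos h]
          exact hg.fst i (j - 1) (by omega)
    · intro h
      refine ⟨fun i => f i (i + 1), ?_, fun i j => if i ≤ j then f i (j + 1) else 0, ?_, ?_⟩
      · intro i
        have h1 := h.fst i (i + 1) le_rfl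
        have h2 := h.snd i i le_rfl
        rw [h.diag (i + 1) (by omega)] at h1
        rw [h.diag i (by omega)] at h2
        exact ⟨h1, h2⟩
      · rw [ih]
        refine ⟨?_, ?_, ?_, ?_, ?_⟩
        · intro i hi; simp
        · intro i j hij; simp; omega
        · intro i j hij
          split_ifs
          · exact h.high _ _ (by omega)
          · rfl
        · intro i j hij
          rw [if_pos (by omega), if_pos hij]
          exact h.snd _ _ (by omega)
        · intro i j hij
          rw [if_pos (by omega), if_pos (by omega)]
          exact h.fst _ _ (by omega)
      · ext i j
        simp only [mbAdd]
        split_ifs with h1 h2 h3 h4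
        · subst h1; exact (h.diag i h2).symm
        · exact (h.high i j (by omega)).symm
        · congr 1; omega
        · omega
        · exact (h.low i j (by omega)).symm

def mbWt (n : ℕ) (f : ℕ → ℕ → ℕ) : ℕ :=
  ∑ i ∈ Finset.range n, ∑ j ∈ Finset.range n, if i < j then f i j else 0

lemma mbWt_add (n : ℕ) (lam : Fin (n + 1) → ℕ) (mu : Fin n → ℕ) (g : ℕ → ℕ → ℕ)
    (hg : MbTri n mu g) : mbWt (n + 1) (mbAdd n lam g) = (∑ i, mu i) + mbWt n g := by
  have h1 : ∀ i j, (if i < j + 1 then mbAdd n lam g i (j + 1) else 0) =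
      (if i = j then g i i else 0) + if i < j then g i j else 0 := by
    intro i j
    simp only [mbAdd]
    rcases lt_trichotomy i j with h | h | h
    · rw [if_pos (by omega), if_neg (by omega), if_pos (by omega), if_neg (by omega), if_pos h]
      simp
    · subst h; simp
    · rw [if_neg (by omega), if_neg (by omega), if_neg (by omega)]
  have h2 : ∑ i, mu i = ∑ i ∈ Finset.range n, g i i := by
    rw [Finset.sum_range]
    exact Finset.sum_congr rfl fun i _ => (hg.diag i i.2).symm
  simp only [mbWt]
  rw [h2, ← Finset.sum_add_distrib, Finset.sum_range_succ]
  have h3 : ∑ j ∈ Finset.range (n + 1), (if n < j then mbAdd n lam g n j else 0) = 0 :=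
    Finset.sum_eq_zero fun j hj => by
      rw [if_neg]; have := Finset.mem_range.1 hj; omega
  rw [h3, add_zero]
  refine Finset.sum_congr rfl fun i hi => ?_
  rw [Finset.sum_range_succ']
  simp only [h1, Finset.sum_add_distrib]
  simp only [Finset.sum_ite_eq, hi, if_true]
  simp

lemma mbG_sum (Q : ℝ) (n : ℕ) : ∀ lam : Fin n → ℕ, ∑ f ∈ mbP n lam, Q ^ mbWt n f = mbG Q n lam := by
  classical
  induction n with
  | zero => intro lam; simp [mbP, mbG, mbWt]
  | succ n ih =>
    intro lam
    have key : ∀ mu g, g ∈ mbP n mu → ∀ i j, g i j = if i ≤ j then mbAdd n lam g i (j + 1) else 0 := by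
      intro mu g hg i j
      rw [mbP_mem] at hg
      simp only [mbAdd]
      split_ifs with h1 h2 <;> try omega
      · rfl
      · exact hg.low _ _ (by omega)
    simp only [mbP, mbG]
    rw [Finset.sum_biUnion]
    · refine Finset.sum_congr rfl fun mu _ => ?_
      rw [Finset.sum_image, ← ih, Finset.mul_sum]
      · refine Finset.sum_congr rfl fun g hg => ?_
        rw [mbWt_add n lam mu g ((mbP_mem _ _ _).1 hg), pow_add]
      · intro g hg g' hg' he
        ext i j
        rw [key mu g hg, key mu g' hg', he]
    · intro mu _ nu _ hne
      rw [Function.onFun, Finset.disjoint_left]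
      intro f hf hf'
      apply hne
      obtain ⟨g, hg, rfl⟩ := Finset.mem_image.1 hf
      obtain ⟨g', hg', he⟩ := Finset.mem_image.1 hf'
      ext i
      have a1 := ((mbP_mem _ _ _).1 hg).diag i i.2
      have a2 := ((mbP_mem _ _ _).1 hg').diag i i.2
      rw [key mu g hg] at a1
      rw [key nu g' hg', he, a1] at a2
      exact a2

lemma mb_pp_ext {M N : ℕ∞} {A B : PlanePartition M N} (h : ∀ i j, A.part i j = B.part i j) :
    A = B := by
  cases A; cases B
  simp only [PlanePartition.mk.injEq]
  ext i j; exact h i j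

lemma mbExt_lt (M K : ℕ) (lam : Fin M → ℕ) (i : ℕ) (h : i < M) (h' : i < M + K) :
    mbExt M K lam ⟨i, h'⟩ = lam ⟨i, h⟩ := by
  have : (⟨i, h'⟩ : Fin (M + K)) = Fin.castAdd K ⟨i, h⟩ := rfl
  rw [this, mbExt, Fin.append_left]

lemma mbExt_ge (M K : ℕ) (lam : Fin M → ℕ) (i : ℕ) (h : M ≤ i) (h' : i < M + K) :
    mbExt M K lam ⟨i, h'⟩ = 0 := by
  have : (⟨i, h'⟩ : Fin (M + K)) = Fin.natAdd M ⟨i - M, by omega⟩ := by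
    ext; simp; omega
  rw [this, mbExt, Fin.append_right]

def mbLeft {M N : ℕ∞} (Λ : PlanePartition M N) : ℕ → ℕ → ℕ :=
  fun i j => if i ≤ j then Λ.part j i else 0

def mbRight {M N : ℕ∞} (Λ : PlanePartition M N) : ℕ → ℕ → ℕ :=
  fun i j => if i ≤ j then Λ.part i j else 0

lemma mbLeft_tri {M K : ℕ} (lam : Fin M → ℕ) (Λ : PlanePartition (M : ℕ∞) ((M + K : ℕ) : ℕ∞))
    (h : ∀ i : Fin M, Λ.part i i = lam i) : MbTri M lam (mbLeft Λ) := by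
  refine ⟨?_, ?_, ?_, ?_, ?_⟩ <;> simp only [mbLeft]
  · intro i hi; simpa using h ⟨i, hi⟩
  · intro i j hij; rw [if_neg (by omega)]
  · intro i j hij; rw [Λ.supp_fst _ _ (by exact_mod_cast hij)]; simp
  · intro i j hij; rw [if_pos (by omega), if_pos hij]; exact Λ.antitone_fst _ _
  · intro i j hij; rw [if_pos (by omega), if_pos (by omega)]; exact Λ.antitone_snd _ _

lemma mbRight_tri {M K : ℕ} (lam : Fin M → ℕ) (Λ : PlanePartition (M : ℕ∞) ((M + K : ℕ) : ℕ∞))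
    (h : ∀ i : Fin M, Λ.part i i = lam i) : MbTri (M + K) (mbExt M K lam) (mbRight Λ) := by
  refine ⟨?_, ?_, ?_, ?_, ?_⟩ <;> simp only [mbRight]
  · intro i hi
    rw [if_pos le_rfl]
    by_cases hM : i < M
    · rw [mbExt_lt M K lam i hM hi]; exact h ⟨i, hM⟩
    · rw [mbExt_ge M K lam i (by omega) hi]
      exact Λ.supp_fst _ _ (by exact_mod_cast (by omega : M ≤ i))
  · intro i j hij; rw [if_neg (by omega)]
  · intro i j hij; rw [Λ.supp_snd _ _ (by exact_mod_cast hij)]; simp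
  · intro i j hij; rw [if_pos (by omega), if_pos hij]; exact Λ.antitone_snd _ _
  · intro i j hij; rw [if_pos (by omega), if_pos (by omega)]; exact Λ.antitone_fst _ _

def mbGlue {M K : ℕ} (lam : Fin M → ℕ) (l r : ℕ → ℕ → ℕ) (hl : MbTri M lam l)
    (hr : MbTri (M + K) (mbExt M K lam) r) : PlanePartition (M : ℕ∞) ((M + K : ℕ) : ℕ∞) :=
  have hd : ∀ i, l i i = r i i := by
    intro i
    by_cases h : i < M
    · rw [hl.diag i h, hr.diag i (by omega), mbExt_lt M K lam i h]
    · rw [hl.high i i (by omega)]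
      by_cases h' : i < M + K
      · rw [hr.diag i h', mbExt_ge M K lam i (by omega)]
      · rw [hr.high i i (by omega)]
  have h1 : ∀ i j : ℕ, M ≤ i → (if i ≤ j then r i j else l j i) = 0 := by
    intro i j hi
    split_ifs with hij
    · have : r i j ≤ r i i := by
        induction j, hij using Nat.le_induction with
        | base => exact le_rfl
        | succ j hj ih => exact (hr.snd i j hj).trans ih
      rw [← hd, hl.high i i hi] at this
      omega
    · exact hl.high _ _ hi
  have h2 : ∀ i j : ℕ, M + K ≤ j → (if i ≤ j then r i j else l j i) = 0 := by
    intro i j hj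
    split_ifs with hij
    · exact hr.high _ _ hj
    · exact hl.high _ _ (by omega)
  { part := fun i j => if i ≤ j then r i j else l j i
    antitone_fst := by
      intro i j
      rcases lt_trichotomy i j with h | h | h
      · rw [if_pos (by omega), if_pos (by omega)]; exact hr.fst _ _ h
      · subst h
        rw [if_neg (by omega), if_pos le_rfl, ← hd]; exact hl.snd _ _ le_rfl
      · rw [if_neg (by omega), if_neg (by omega)]; exact hl.snd _ _ h.le
    antitone_snd := by
      intro i j
      rcases lt_trichotomy i (j + 1) with h | h | h
      · rw [if_pos (by omega), if_pos (by omega)]; exact hr.snd _ _ (by omega)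
      · subst h
        rw [if_pos le_rfl, if_neg (by omega), ← hd]; exact hl.fst _ _ le_rfl
      · rw [if_neg (by omega), if_neg (by omega)]; exact hl.fst _ _ h.le
    supp_fst := fun i j h => h1 i j (by exact_mod_cast h)
    supp_snd := fun i j h => h2 i j (by exact_mod_cast h)
    finite_supp := by
      refine ((Finset.range M) ×ˢ (Finset.range (M + K))).finite_toSet.subset ?_
      rintro ⟨i, j⟩ h
      simp only [Set.mem_ofPred_eq] at h
      simp only [Finset.coe_product, Finset.coe_range, Set.mem_prod, Set.mem_Iio]
      constructor
      · by_contra hc; exact h (h1 i j (by omega))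
      · by_contra hc; exact h (h2 i j (by omega)) }

def mbEquiv {M K : ℕ} (lam : Fin M → ℕ) :
    ({Λ | ∀ i : Fin M, Λ.part i i = lam i} : Set (PlanePartition (M : ℕ∞) ((M + K : ℕ) : ℕ∞))) ≃
      ↥(mbP M lam ×ˢ mbP (M + K) (mbExt M K lam)) where
  toFun Λ := ⟨(mbLeft Λ.1, mbRight Λ.1), Finset.mem_product.2
    ⟨(mbP_mem _ _ _).2 (mbLeft_tri lam Λ.1 Λ.2), (mbP_mem _ _ _).2 (mbRight_tri lam Λ.1 Λ.2)⟩⟩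
  invFun p := ⟨mbGlue lam p.1.1 p.1.2 ((mbP_mem _ _ _).1 (Finset.mem_product.1 p.2).1)
    ((mbP_mem _ _ _).1 (Finset.mem_product.1 p.2).2), by
      intro i
      have hr := ((mbP_mem _ _ _).1 (Finset.mem_product.1 p.2).2)
      simp only [mbGlue, le_refl, if_true]
      rw [hr.diag i (by omega), mbExt_lt M K lam i i.2]⟩
  left_inv Λ := by
    apply Subtype.ext
    apply mb_pp_ext
    intro i j
    simp only [mbGlue, mbLeft, mbRight]
    split_ifs <;> first | rfl | omega
  right_inv p := by
    have hl := ((mbP_mem _ _ _).1 (Finset.mem_product.1 p.2).1)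
    have hr := ((mbP_mem _ _ _).1 (Finset.mem_product.1 p.2).2)
    apply Subtype.ext
    apply Prod.ext
    · ext i j
      simp only [mbGlue, mbLeft]
      split_ifs with h1 h2
      · have : i = j := by omega
        subst this
        by_cases h : i < M
        · rw [hl.diag i h, hr.diag i (by omega), mbExt_lt M K lam i h]
        · rw [hl.high i i (by omega)]
          by_cases h' : i < M + K
          · rw [hr.diag i h', mbExt_ge M K lam i (by omega)]
          · rw [hr.high i i (by omega)]
      · rfl
      · exact (hl.low _ _ (by omega)).symm
    · ext i j
      simp only [mbGlue, mbRight]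
      split_ifs with h1
      · rfl
      · exact (hr.low _ _ (by omega)).symm

lemma mb_leftVol {M K : ℕ} (Λ : PlanePartition (M : ℕ∞) ((M + K : ℕ) : ℕ∞)) :
    Λ.leftVol = mbWt M (mbLeft Λ) := by
  rw [PlanePartition.leftVol, finsum_eq_sum_of_support_subset (s := Finset.range M ×ˢ Finset.range M),
    Finset.sum_product_right, mbWt]
  · refine Finset.sum_congr rfl fun i _ => Finset.sum_congr rfl fun j _ => ?_
    simp only [mbLeft]
    split_ifs <;> first | rfl | omega
  · rintro ⟨i, j⟩ h
    simp only [Function.mem_support, ne_eq, ite_eq_right_iff, not_forall] at h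
    obtain ⟨h, h'⟩ := h
    have : i < M := by
      by_contra hc
      exact h' (Λ.supp_fst _ _ (by exact_mod_cast (by omega : M ≤ i)))
    simp; omega

lemma mb_rightVol {M K : ℕ} (Λ : PlanePartition (M : ℕ∞) ((M + K : ℕ) : ℕ∞)) :
    Λ.rightVol = mbWt (M + K) (mbRight Λ) := by
  rw [PlanePartition.rightVol, finsum_eq_sum_of_support_subset
    (s := Finset.range (M + K) ×ˢ Finset.range (M + K)), Finset.sum_product, mbWt]
  · refine Finset.sum_congr rfl fun i _ => Finset.sum_congr rfl fun j _ => ?_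
    simp only [mbRight]
    split_ifs <;> first | rfl | omega
  · rintro ⟨i, j⟩ h
    simp only [Function.mem_support, ne_eq, ite_eq_right_iff, not_forall] at h
    obtain ⟨h, h'⟩ := h
    have : j < M + K := by
      by_contra hc
      exact h' (Λ.supp_snd _ _ (by exact_mod_cast (by omega : M + K ≤ j)))
    simp; omega

lemma mb_centralVol {M K : ℕ} (Λ : PlanePartition (M : ℕ∞) ((M + K : ℕ) : ℕ∞)) :
    Λ.centralVol = ∑ i : Fin M, Λ.part i i := by
  rw [PlanePartition.centralVol, finsum_eq_sum_of_support_subset (s := Finset.range M),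
    Finset.sum_range]
  intro i h
  have : i < M := by
    by_contra hc
    exact h (Λ.supp_fst _ _ (by exact_mod_cast (by omega : M ≤ i)))
  simpa using this

lemma mb_fiber (q a η θ : ℝ) (M K : ℕ) (lam : Fin M → ℕ) :
    (∑' Λ : ({Λ | ∀ i : Fin M, Λ.part i i = lam i} :
      Set (PlanePartition (M : ℕ∞) ((M + K : ℕ) : ℕ∞))), mbWeight q a η θ Λ.1) =
    mbG (q ^ η) M lam * (a * Real.sqrt ((q ^ η) * (q ^ θ))) ^ (∑ i, lam i) *
      mbG (q ^ θ) (M + K) (mbExt M K lam) := by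
  have h : ∀ Λ : ({Λ | ∀ i : Fin M, Λ.part i i = lam i} :
      Set (PlanePartition (M : ℕ∞) ((M + K : ℕ) : ℕ∞))), mbWeight q a η θ Λ.1 =
      (fun p : (ℕ → ℕ → ℕ) × (ℕ → ℕ → ℕ) => (q ^ η) ^ mbWt M p.1 *
        (a * Real.sqrt ((q ^ η) * (q ^ θ))) ^ (∑ i, lam i) * (q ^ θ) ^ mbWt (M + K) p.2)
        (mbEquiv lam Λ).1 := by
    intro Λ
    have e : ∑ i, lam i = Λ.1.centralVol := by
      rw [mb_centralVol]
      exact Finset.sum_congr rfl fun i _ => (Λ.2 i).symm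
    rw [e, mbWeight, mb_leftVol, mb_rightVol]
    rfl
  rw [tsum_congr h, (mbEquiv lam).tsum_eq (fun p => (fun p : (ℕ → ℕ → ℕ) × (ℕ → ℕ → ℕ) => (q ^ η) ^ mbWt M p.1 *
        (a * Real.sqrt ((q ^ η) * (q ^ θ))) ^ (∑ i, lam i) * (q ^ θ) ^ mbWt (M + K) p.2) p.1)]
  refine (Finset.tsum_subtype _ (fun p : (ℕ → ℕ → ℕ) × (ℕ → ℕ → ℕ) => (q ^ η) ^ mbWt M p.1 *
        (a * Real.sqrt ((q ^ η) * (q ^ θ))) ^ (∑ i, lam i) * (q ^ θ) ^ mbWt (M + K) p.2)).trans ?_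
  rw [Finset.sum_product, ← mbG_sum, ← mbG_sum, Finset.sum_mul, Finset.sum_mul_sum]

lemma mb_summable_pi {ι : Type*} [Fintype ι] [DecidableEq ι] (r : ℝ) (h0 : 0 ≤ r) (h1 : r < 1) :
    Summable fun f : ι → ℕ => r ^ (∑ i, f i) := by
  refine summable_of_sum_le (c := ∏ i : ι, (1 - r)⁻¹) (fun f => pow_nonneg h0 _) fun u => ?_
  have hsub : u ⊆ Fintype.piFinset fun i : ι => u.image (fun f => f i) := by
    intro f hf
    rw [Fintype.mem_piFinset]
    intro i
    exact Finset.mem_image_of_mem _ hf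
  refine (Finset.sum_le_sum_of_subset_of_nonneg hsub fun f _ _ => pow_nonneg h0 _).trans ?_
  simp only [← Finset.prod_pow_eq_pow_sum]
  rw [← Finset.prod_univ_sum (fun i : ι => u.image (fun f => f i)) (fun _ m => r ^ m)]
  refine Finset.prod_le_prod (fun i _ => Finset.sum_nonneg fun _ _ => pow_nonneg h0 _) fun i _ => ?_
  rw [← tsum_geometric_of_lt_one h0 h1]
  exact (summable_geometric_of_lt_one h0 h1).sum_le_tsum _ fun _ _ => pow_nonneg h0 _

lemma mb_summable (q a η θ : ℝ) (M K : ℕ)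
    (hQ0 : 0 < q ^ η) (hQ1 : q ^ η < 1) (hR0 : 0 < q ^ θ) (hR1 : q ^ θ < 1)
    (ha0 : 0 < a) (ha1 : a ≤ 1) :
    Summable fun Λ : PlanePartition (M : ℕ∞) ((M + K : ℕ) : ℕ∞) => mbWeight q a η θ Λ := by
  set Q := q ^ η with hQ
  set R := q ^ θ with hR
  set t := a * Real.sqrt (Q * R) with ht
  have ht0 : 0 < t := by positivity
  have ht1 : t < 1 := by
    have : Real.sqrt (Q * R) < 1 := by
      rw [Real.sqrt_lt' one_pos]; nlinarith
    have := Real.sqrt_nonneg (Q * R)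
    nlinarith
  set r := max (max Q R) t with hr
  have hr0 : 0 ≤ r := ht0.le.trans (le_max_right _ _)
  have hr1 : r < 1 := max_lt (max_lt hQ1 hR1) ht1
  let φ : PlanePartition (M : ℕ∞) ((M + K : ℕ) : ℕ∞) → (Fin M × Fin (M + K) → ℕ) :=
    fun Λ p => Λ.part p.1 p.2
  have hφ : Function.Injective φ := by
    intro A B h
    apply mb_pp_ext
    intro i j
    by_cases hi : i < M
    · by_cases hj : j < M + K
      · exact congrFun h (⟨i, hi⟩, ⟨j, hj⟩)
      · rw [A.supp_snd _ _ (by exact_mod_cast (by omega : M + K ≤ j)),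
          B.supp_snd _ _ (by exact_mod_cast (by omega : M + K ≤ j))]
    · rw [A.supp_fst _ _ (by exact_mod_cast (by omega : M ≤ i)),
          B.supp_fst _ _ (by exact_mod_cast (by omega : M ≤ i))]
  refine Summable.of_nonneg_of_le (fun Λ => ?_) (fun Λ => ?_)
    ((mb_summable_pi (ι := Fin M × Fin (M + K)) r hr0 hr1).comp_injective hφ)
  · rw [mbWeight]; positivity
  · have hsum : Λ.leftVol + Λ.centralVol + Λ.rightVol = ∑ p, φ Λ p := by
      have hsup : ∀ i j, Λ.part i j ≠ 0 → i < M ∧ j < M + K := by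
        intro i j h
        constructor
        · by_contra hc
          exact h (Λ.supp_fst _ _ (by exact_mod_cast (by omega : M ≤ i)))
        · by_contra hc
          exact h (Λ.supp_snd _ _ (by exact_mod_cast (by omega : M + K ≤ j)))
      have hc : Λ.centralVol = ∑ i ∈ Finset.range M, ∑ j ∈ Finset.range (M + K),
          if i = j then Λ.part i j else 0 := by
        rw [mb_centralVol, Finset.sum_range]
        refine Finset.sum_congr rfl fun i _ => ?_
        rw [Finset.sum_ite_eq, if_pos]
        simp; omega
      rw [hc, PlanePartition.leftVol, PlanePartition.rightVol,
        finsum_eq_sum_of_support_subset (s := Finset.range M ×ˢ Finset.range (M + K)),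
        finsum_eq_sum_of_support_subset (s := Finset.range M ×ˢ Finset.range (M + K)),
        Finset.sum_product, Finset.sum_product, ← Finset.sum_add_distrib, ← Finset.sum_add_distrib,
        Fintype.sum_prod_type, Finset.sum_range]
      · refine Finset.sum_congr rfl fun i _ => ?_
        rw [← Finset.sum_add_distrib, ← Finset.sum_add_distrib, Finset.sum_range]
        refine Finset.sum_congr rfl fun j _ => ?_
        simp only [φ]
        rcases lt_trichotomy (i : ℕ) (j : ℕ) with h | h | h
        · rw [if_neg (by omega), if_neg (by omega), if_pos h]; simp
        · rw [if_neg (by omega), if_pos h, if_neg (by omega)]; simp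
        · rw [if_pos h, if_neg (by omega), if_neg (by omega)]; simp
      all_goals
        rintro ⟨i, j⟩ h
        simp only [Function.mem_support, ne_eq, ite_eq_right_iff, not_forall] at h
        obtain ⟨_, h'⟩ := h
        have := hsup i j h'
        simp; omega
    simp only [Function.comp]
    rw [← hsum, mbWeight, pow_add, pow_add]
    have b1 : Q ≤ r := (le_max_left _ _).trans (le_max_left _ _)
    have b2 : R ≤ r := (le_max_right _ _).trans (le_max_left _ _)
    have b3 : t ≤ r := le_max_right _ _
    gcongr

/-- the distribution of the central slice of a Muttalib–Borodin distributed
`(M,N)`-based plane partition (0-based indices; `l_i = λ_i + M - 1 - i`). -/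
theorem statement1 (M N : ℕ) (hM : 0 < M) (hMN : M ≤ N) (q a η θ : ℝ)
    (hq0 : 0 < q) (hq1 : q < 1) (ha0 : 0 < a) (ha1 : a ≤ 1) (hη : 0 < η) (hθ : 0 < θ) :
    ∃ C : ℝ, 0 < C ∧ ∀ lam : Fin M → ℕ, Antitone lam →
      mbProb q a η θ (M : ℕ∞) (N : ℕ∞) {Λ | ∀ i : Fin M, Λ.part i i = lam i} =
        C * ((∏ i : Fin M, ∏ j : Fin M, if i < j then
                ((q ^ η) ^ (lam j + (M - 1 - (j : ℕ))) - (q ^ η) ^ (lam i + (M - 1 - (i : ℕ)))) *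
                ((q ^ θ) ^ (lam j + (M - 1 - (j : ℕ))) - (q ^ θ) ^ (lam i + (M - 1 - (i : ℕ))))
              else 1) *
          ∏ i : Fin M, (a * Real.sqrt ((q ^ η) * (q ^ θ))) ^ (lam i + (M - 1 - (i : ℕ))) *
            qPoch ((q ^ θ) ^ (lam i + (M - 1 - (i : ℕ)) + 1)) (q ^ θ) (N - M)) := by
  obtain ⟨K, rfl⟩ := Nat.exists_eq_add_of_le hMN
  have hQ0 : 0 < q ^ η := Real.rpow_pos_of_pos hq0 _
  have hQ1 : q ^ η < 1 := Real.rpow_lt_one hq0.le hq1 hη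
  have hR0 : 0 < q ^ θ := Real.rpow_pos_of_pos hq0 _
  have hR1 : q ^ θ < 1 := Real.rpow_lt_one hq0.le hq1 hθ
  have hS := mb_summable q a η θ M K hQ0 hQ1 hR0 hR1 ha0 ha1
  have ht0 : 0 < a * Real.sqrt ((q ^ η) * (q ^ θ)) := by positivity
  have hw : ∀ Λ : PlanePartition (M : ℕ∞) ((M + K : ℕ) : ℕ∞), 0 < mbWeight q a η θ Λ := by
    intro Λ
    rw [mbWeight]; positivity
  have hZ := hS.tsum_pos (fun Λ => (hw Λ).le)
    ⟨fun _ _ => 0, fun _ _ => le_rfl, fun _ _ => le_rfl, fun _ _ _ => rfl, fun _ _ _ => rfl,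
      by simp⟩ (hw _)
  obtain ⟨c1, hc1, h1⟩ := mbG_eq (q ^ η) hQ0 hQ1 M
  obtain ⟨c2, hc2, h2⟩ := mbG_eq (q ^ θ) hR0 hR1 (M + K)
  obtain ⟨c3, hc3, h3⟩ := mbV_ext (q ^ θ) hR0 hR1 M K
  set Z := ∑' Λ : PlanePartition (M : ℕ∞) ((M + K : ℕ) : ℕ∞), mbWeight q a η θ Λ with hZdef
  set t := a * Real.sqrt ((q ^ η) * (q ^ θ)) with ht
  have hs : 0 < t ^ (∑ i : Fin M, (M - 1 - (i : ℕ))) := by positivity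
  refine ⟨c1 * c2 * c3 / (t ^ (∑ i : Fin M, (M - 1 - (i : ℕ))) * Z), by positivity, ?_⟩
  intro lam hl
  have hl' : Antitone (mbExt M K lam) := by
    rintro ⟨i, hi⟩ ⟨j, hj⟩ hij
    rw [Fin.mk_le_mk] at hij
    by_cases hjM : j < M
    · rw [mbExt_lt M K lam j hjM, mbExt_lt M K lam i (by omega)]
      exact hl hij
    · rw [mbExt_ge M K lam j (by omega)]
      exact Nat.zero_le _
  rw [mbProb, mb_fiber, h1 lam hl, h2 _ hl', h3, ← ht, ← hZdef]
  have e1 : (∏ i : Fin M, ∏ j : Fin M, if i < j then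
      ((q ^ η) ^ (lam j + (M - 1 - (j : ℕ))) - (q ^ η) ^ (lam i + (M - 1 - (i : ℕ)))) *
      ((q ^ θ) ^ (lam j + (M - 1 - (j : ℕ))) - (q ^ θ) ^ (lam i + (M - 1 - (i : ℕ))))
      else 1) = mbV (q ^ η) M lam * mbV (q ^ θ) M lam := by
    rw [mbV_eq, mbV_eq, ← Finset.prod_mul_distrib]
    refine Finset.prod_congr rfl fun i _ => ?_
    rw [← Finset.prod_mul_distrib]
    refine Finset.prod_congr rfl fun j _ => ?_
    split_ifs <;> simp
  rw [e1, Nat.add_sub_cancel_left, Finset.prod_mul_distrib, Finset.prod_pow_eq_pow_sum,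
    Finset.sum_add_distrib, pow_add]
  field_simp

end
end

section
/- Fix a real c>0. For r>0 set u=e^{−r}. Then there exist constants C>0 and r₀>0 such that for all 0<r<r₀, | log((u^c;u)_∞) − ( −π²/(6r) + (1/2−c)·log r + (1/2)·log(2π) − log Γ(c) ) | ≤ C·r, where Γ is the Gamma function. -/
open MeasureTheory Filter Topology Set

noncomputable section



def sL (x : ℝ) : ℝ := ∑' k : ℕ, Real.exp (-x) ^ (k + 1) / ((k : ℝ) + 1) ^ 2
def sf (x : ℝ) : ℝ := Real.log (1 - Real.exp (-x))
def sg (x : ℝ) : ℝ := sf x - Real.log x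
def sqq (x : ℝ) : ℝ := 1 / (Real.exp x - 1) - 1 / x
def sP (x : ℝ) : ℝ := sL x - x * Real.log x + x

lemma s_exp_lt {x : ℝ} (hx : 0 < x) : Real.exp (-x) < 1 := by
  rw [Real.exp_lt_one_iff]; linarith

lemma s_summable : Summable (fun k : ℕ => 1 / ((k : ℝ) + 1) ^ 2) := by
  have := (summable_nat_add_iff 1).2 (Real.summable_one_div_nat_pow.2 (one_lt_two))
  simpa using this

lemma s_term_le {x : ℝ} (hx : 0 ≤ x) (k : ℕ) :
    ‖Real.exp (-x) ^ (k + 1) / ((k : ℝ) + 1) ^ 2‖ ≤ 1 / ((k : ℝ) + 1) ^ 2 := by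
  rw [Real.norm_of_nonneg (by positivity)]
  gcongr
  exact pow_le_one₀ (Real.exp_pos _).le (by rw [Real.exp_le_one_iff]; linarith)

lemma sL_zero : sL 0 = Real.pi ^ 2 / 6 := by
  have h := (hasSum_nat_add_iff' 1).2 hasSum_zeta_two
  simp at h
  simp [sL]
  exact h.tsum_eq

lemma sL_cont : ContinuousOn sL (Ici 0) := by
  unfold sL
  refine continuousOn_tsum (u := fun k : ℕ => 1 / ((k : ℝ) + 1) ^ 2) ?_ s_summable ?_
  · intro k; fun_prop
  · intro k x hx; exact s_term_le hx k

lemma sL_deriv {x : ℝ} (hx : 0 < x) : HasDerivAt sL (sf x) x := by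
  have hd : x / 2 < x := by linarith
  have hd0 : 0 < x / 2 := by linarith
  have key := hasDerivAt_tsum_of_isPreconnected (𝕜 := ℝ) (F := ℝ)
    (u := fun k : ℕ => Real.exp (-(x/2)) ^ k)
    (g := fun (k : ℕ) (y : ℝ) => Real.exp (-y) ^ (k + 1) / ((k : ℝ) + 1) ^ 2)
    (g' := fun (k : ℕ) (y : ℝ) => -(Real.exp (-y) ^ (k + 1) / ((k : ℝ) + 1)))
    (t := Ioi (x/2)) (y₀ := x) (y := x)
    (summable_geometric_of_lt_one (Real.exp_pos _).le (s_exp_lt hd0)) isOpen_Ioi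
    isPreconnected_Ioi ?_ ?_ hd ?_ hd
  · have h2 : (∑' k : ℕ, -(Real.exp (-x) ^ (k + 1) / ((k : ℝ) + 1))) = sf x := by
      have := (Real.hasSum_pow_div_log_of_abs_lt_one (x := Real.exp (-x))
        (by rw [abs_of_pos (Real.exp_pos _)]; exact s_exp_lt hx)).neg
      rw [neg_neg] at this
      exact this.tsum_eq
    rw [h2] at key
    exact key
  · intro k y _
    have h1 : HasDerivAt (fun y : ℝ => Real.exp (-y)) (-Real.exp (-y)) y := by
      simpa using (hasDerivAt_neg y).exp
    have h3 := (h1.pow (k+1)).div_const (((k : ℝ) + 1) ^ 2)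
    convert! h3 using 1
    simp
    field_simp
    ring
  · intro k y hy
    rw [norm_neg, Real.norm_of_nonneg (by positivity)]
    have hy' : x / 2 < y := hy
    have h1 : Real.exp (-y) ≤ Real.exp (-(x/2)) := by
      apply Real.exp_le_exp.2; linarith
    have h2 : Real.exp (-y) ≤ 1 := (s_exp_lt (by linarith)).le
    calc Real.exp (-y) ^ (k + 1) / ((k : ℝ) + 1) ≤ Real.exp (-y) ^ (k + 1) :=
          div_le_self (by positivity) (by linarith [(Nat.cast_nonneg k : (0:ℝ) ≤ k)])
      _ ≤ Real.exp (-y) ^ k := pow_le_pow_of_le_one (Real.exp_pos _).le h2 (by omega)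
      _ ≤ _ := by gcongr
  · exact Summable.of_norm_bounded s_summable (fun k => s_term_le hx.le k)

lemma sL_lim : Tendsto sL atTop (𝓝 0) := by
  have : Tendsto sL atTop (𝓝 (∑' k : ℕ, (0:ℝ))) := by
    unfold sL
    refine tendsto_tsum_of_dominated_convergence s_summable ?_ ?_
    · intro k
      have h := (Real.tendsto_exp_neg_atTop_nhds_zero.pow (k+1)).div_const (((k : ℝ) + 1) ^ 2)
      simpa using h
    · filter_upwards [eventually_ge_atTop 0] with x hx k
      exact s_term_le hx k
  simpa using this

lemma sf_lim : Tendsto sf atTop (𝓝 0) := by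
  have h : Tendsto (fun x : ℝ => 1 - Real.exp (-x)) atTop (𝓝 1) := by
    simpa using Real.tendsto_exp_neg_atTop_nhds_zero.const_sub 1
  have h2 := h.log one_ne_zero
  rw [Real.log_one] at h2
  exact h2

lemma sg_deriv {x : ℝ} (hx : 0 < x) : HasDerivAt sg (sqq x) x := by
  have h1 : HasDerivAt (fun y : ℝ => 1 - Real.exp (-y)) (Real.exp (-x)) x := by
    simpa using ((hasDerivAt_neg x).exp).const_sub 1
  have h0 := s_exp_lt hx
  have h2 := (h1.log (by linarith)).sub (Real.hasDerivAt_log hx.ne')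
  have e : sqq x = Real.exp (-x) / (1 - Real.exp (-x)) - x⁻¹ := by
    have h3 : 1 < Real.exp x := Real.one_lt_exp_iff.2 hx
    have h4 : Real.exp x - 1 ≠ 0 := by linarith
    rw [Real.exp_neg] at *
    have : 1 - (Real.exp x)⁻¹ ≠ 0 := by linarith
    unfold sqq
    field_simp
  rw [e]; exact h2

lemma sP_deriv {x : ℝ} (hx : 0 < x) : HasDerivAt sP (sg x) x := by
  have h := ((sL_deriv hx).sub ((hasDerivAt_id x).mul (Real.hasDerivAt_log hx.ne'))).add
    (hasDerivAt_id x)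
  convert! h using 1
  simp [sg, hx.ne']
  ring

lemma sP_cont : ContinuousOn sP (Ici 0) :=
  (sL_cont.sub Real.continuous_mul_log.continuousOn).add continuousOn_id

lemma sg_bd {x : ℝ} (hx : 0 < x) : -x ≤ sg x ∧ sg x ≤ 0 := by
  have h0 := s_exp_lt hx
  have h1 := Real.add_one_le_exp (-x)
  have h2 := Real.add_one_le_exp x
  unfold sg sf
  constructor
  · have : x * Real.exp (-x) ≤ 1 - Real.exp (-x) := by
      have : Real.exp x * Real.exp (-x) = 1 := by rw [← Real.exp_add]; simp
      nlinarith [Real.exp_pos (-x)]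
    have h3 := Real.log_le_log (by positivity) this
    rw [Real.log_mul hx.ne' (Real.exp_pos _).ne', Real.log_exp] at h3
    linarith
  · have := Real.log_le_log (by linarith) (show 1 - Real.exp (-x) ≤ x by linarith)
    linarith

lemma sqq_bd {x : ℝ} (hx : 0 < x) : -1 ≤ sqq x ∧ sqq x ≤ 0 := by
  have h1 := Real.add_one_le_exp (-x)
  have h2 := Real.add_one_le_exp x
  have h3 : Real.exp x * Real.exp (-x) = 1 := by rw [← Real.exp_add]; simp
  have h4 := Real.exp_pos x
  have h5 : 0 < Real.exp x - 1 := by linarith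
  unfold sqq
  rw [div_sub_div _ _ h5.ne' hx.ne']
  have h6 : 0 < (Real.exp x - 1) * x := by positivity
  constructor
  · rw [le_div_iff₀ h6]; nlinarith
  · apply div_nonpos_of_nonpos_of_nonneg _ h6.le; linarith

lemma sqq_mono : MonotoneOn sqq (Ioi 0) := by
  have hd : ∀ x : ℝ, 0 < x → HasDerivAt sqq (1 / x^2 - Real.exp x / (Real.exp x - 1)^2) x := by
    intro x hx
    have h3 : 1 < Real.exp x := Real.one_lt_exp_iff.2 hx
    have h := (((Real.hasDerivAt_exp x).sub_const 1).inv (by linarith)).sub (hasDerivAt_inv hx.ne')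
    convert! h using 1
    · ext y; simp [sqq]
    · field_simp; ring
  apply monotoneOn_of_deriv_nonneg (convex_Ioi 0)
  · intro x hx; exact (hd x hx).continuousAt.continuousWithinAt
  · intro x hx; rw [interior_Ioi] at hx; exact (hd x hx).differentiableAt.differentiableWithinAt
  · intro x hx
    rw [interior_Ioi] at hx
    have hx : 0 < x := hx
    rw [(hd x hx).deriv, sub_nonneg]
    have h3 : 1 < Real.exp x := Real.one_lt_exp_iff.2 hx
    rw [div_le_div_iff₀ (by nlinarith) (by positivity), one_mul]
    have hs := Real.self_le_sinh_iff.2 (show 0 ≤ x/2 by linarith)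
    rw [Real.sinh_eq] at hs
    set a := Real.exp (x/2)
    have ha : Real.exp x = a^2 := by
      rw [← Real.exp_nat_mul]; congr 1; push_cast; ring
    have hb : a * Real.exp (-(x/2)) = 1 := by rw [← Real.exp_add]; simp
    have ha0 : 0 < a := Real.exp_pos _
    rw [ha]
    have : a * x ≤ a^2 - 1 := by nlinarith
    nlinarith [mul_pos ha0 hx]

lemma s_trap {a r : ℝ} (ha : 0 < a) (hr : 0 < r) :
    0 ≤ (sg a + sg (a + r)) / 2 - (sP (a + r) - sP a) / r ∧
    (sg a + sg (a + r)) / 2 - (sP (a + r) - sP a) / r ≤ r * (sqq (a + r) - sqq a) := by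
  have hK : ∀ t ∈ Icc a (a + r), HasDerivAt
      (fun t => (sg a + sg t) / 2 * (t - a) - (sP t - sP a))
      ((sqq t * (t - a) - (sg t - sg a)) / 2) t := by
    intro t ht
    have ht0 : 0 < t := lt_of_lt_of_le ha ht.1
    have h := ((((sg_deriv ht0).const_add (sg a)).div_const 2).mul
      ((hasDerivAt_id t).sub_const a)).sub ((sP_deriv ht0).sub_const (sP a))
    convert! h using 1
    simp; ring
  obtain ⟨t, ht, hte⟩ := exists_hasDerivAt_eq_slope _ _ (show a < a + r by linarith)
    (fun t ht => (hK t ht).continuousAt.continuousWithinAt)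
    (fun t ht => hK t (Ioo_subset_Icc_self ht))
  obtain ⟨s, hs, hse⟩ := exists_hasDerivAt_eq_slope sg sqq ht.1
    (fun t ht => (sg_deriv (lt_of_lt_of_le ha ht.1)).continuousAt.continuousWithinAt)
    (fun t ht => sg_deriv (lt_trans ha ht.1))
  have hta : 0 < t - a := by linarith [ht.1]
  rw [eq_div_iff hta.ne'] at hse
  have e : (sg a + sg (a + r)) / 2 - (sP (a + r) - sP a) / r
      = (t - a) * (sqq t - sqq s) / 2 := by
    rw [← hse] at hte
    have e2 : (sg a + sg (a + r)) / 2 - (sP (a + r) - sP a) / r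
      = ((sg a + sg (a + r)) / 2 * (a + r - a) - (sP (a + r) - sP a)
        - ((sg a + sg a) / 2 * (a - a) - (sP a - sP a))) / (a + r - a) := by
      have : a + r - a = r := by ring
      rw [this]
      field_simp
      ring
    rw [e2, ← hte]
    ring
  rw [e]
  have hs0 : 0 < s := lt_trans ha hs.1
  have m1 := sqq_mono (show s ∈ Ioi 0 from hs0) (show t ∈ Ioi 0 from lt_trans ha ht.1) hs.2.le
  have m2 := sqq_mono (show a ∈ Ioi 0 from ha) (show s ∈ Ioi 0 from hs0) hs.1.le
  have m3 := sqq_mono (show t ∈ Ioi 0 from lt_trans ha ht.1)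
    (show a + r ∈ Ioi 0 from add_pos ha hr) ht.2.le
  have : t - a ≤ r := by linarith [ht.2]
  constructor
  · have := mul_nonneg hta.le (sub_nonneg.2 m1); linarith
  · have h1 : (t - a) * (sqq t - sqq s) ≤ r * (sqq (a + r) - sqq a) := by
      apply mul_le_mul this (by linarith) (by linarith) hr.le
    have h2 := mul_nonneg hta.le (sub_nonneg.2 m1)
    linarith
  
lemma s_sum {c r : ℝ} (hc : 0 < c) (hr : 0 < r) (N : ℕ) :
    let E := ∑ n ∈ Finset.range N, sg (r * (n + c)) + (sg (r * (N + c)) - sg (r * c)) / 2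
      - (sP (r * (N + c)) - sP (r * c)) / r
    0 ≤ E ∧ E ≤ r * (sqq (r * (N + c)) - sqq (r * c)) := by
  induction N with
  | zero => simp
  | succ N ih =>
    have h := s_trap (a := r * (N + c)) (r := r) (by positivity) hr
    have e : r * (N + c) + r = r * ((N + 1 : ℕ) + c) := by push_cast; ring
    rw [e] at h
    rw [Finset.sum_range_succ]
    simp only at ih ⊢
    simp only [sub_div] at h ih ⊢
    constructor <;> linarith [h.1, h.2, ih.1, ih.2]

lemma sP_bd {x : ℝ} (hx : 0 < x) : |sP x - Real.pi ^ 2 / 6| ≤ x ^ 2 := by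
  obtain ⟨t, ht, hte⟩ := exists_hasDerivAt_eq_slope sP sg hx
    (sP_cont.mono Icc_subset_Ici_self) (fun t ht => sP_deriv ht.1)
  have h0 : sP 0 = Real.pi ^ 2 / 6 := by simp [sP, sL_zero]
  rw [h0, sub_zero, eq_div_iff hx.ne'] at hte
  rw [← hte, abs_mul, abs_of_pos hx, sq]
  have := sg_bd ht.1
  gcongr
  rw [abs_le]; constructor <;> linarith [ht.2, ht.1, this.1, this.2]

lemma s_stirling {c : ℝ} (hc : 0 < c) :
    Tendsto (fun N : ℕ => ∑ n ∈ Finset.range N, Real.log (n + c)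
      - (N + c - 1/2) * Real.log (N + c) + (N + c)) atTop
      (𝓝 (1 / 2 * Real.log (2 * Real.pi) - Real.log (Real.Gamma c))) := by
  have h1 := Real.BohrMollerup.tendsto_log_gamma hc
  have h2 : Tendsto (fun n : ℕ => Real.log (Stirling.stirlingSeq n)) atTop
    (𝓝 (Real.log (Real.sqrt Real.pi))) :=
    Stirling.tendsto_stirlingSeq_sqrt_pi.log (by positivity)
  have h3 : Tendsto (fun N : ℕ => (N : ℝ) * Real.log (1 + c / N)) atTop (𝓝 c) :=
    (Real.tendsto_mul_log_one_add_div_atTop c).comp tendsto_natCast_atTop_atTop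
  have h4 : Tendsto (fun N : ℕ => Real.log (1 + c / N)) atTop (𝓝 0) := by
    have : Tendsto (fun N : ℕ => 1 + c / (N:ℝ)) atTop (𝓝 1) := by
      simpa using (tendsto_const_div_atTop_nhds_zero_nat c).const_add 1
    simpa using this.log one_ne_zero
  have h := (((h2.add_const (1/2 * Real.log 2)).sub h3).sub (h4.const_mul (c + 1/2))).add_const c
    |>.sub h1
  have e : Real.log √Real.pi + 1 / 2 * Real.log 2 - c - (c + 1 / 2) * 0 + c - Real.log (Real.Gamma c) = 1 / 2 * Real.log (2 * Real.pi) - Real.log (Real.Gamma c) := by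
    rw [Real.log_sqrt Real.pi_pos.le, Real.log_mul two_ne_zero Real.pi_pos.ne']; ring
  rw [e] at h
  refine h.congr' ?_
  filter_upwards [eventually_gt_atTop 0] with N hN
  have hN' : (0:ℝ) < N := by exact_mod_cast hN
  have l1 : Real.log (1 + c / N) = Real.log (N + c) - Real.log N := by
    rw [← Real.log_div (by positivity) hN'.ne']; congr 1; field_simp
  rw [l1, Real.BohrMollerup.logGammaSeq, Finset.sum_range_succ, Stirling.log_stirlingSeq_formula,
    Real.log_mul two_ne_zero hN'.ne', Real.log_div hN'.ne' (Real.exp_pos 1).ne', Real.log_exp,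
    Finset.sum_congr rfl (fun n _ => by rw [add_comm c (n:ℝ)]), add_comm c (N:ℝ)]
  ring

lemma s_logprod {c r : ℝ} (hc : 0 < c) (hr : 0 < r) :
    Tendsto (fun N : ℕ => ∑ n ∈ Finset.range N, sf (r * (n + c))) atTop
      (𝓝 (Real.log (∏' i : ℕ, (1 - Real.exp (-r) ^ (c + (i : ℝ)))))) := by
  have e : ∀ i : ℕ, Real.exp (-r) ^ (c + (i : ℝ)) = Real.exp (-(r * (i + c))) := by
    intro i; rw [← Real.exp_mul]; congr 1; ring
  simp only [e]
  have hs : Summable (fun i : ℕ => Real.exp (-(r * (i + c)))) := by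
    have h := (summable_geometric_of_lt_one (Real.exp_pos _).le (s_exp_lt hr)).mul_left
      (Real.exp (-(r*c)))
    refine h.congr fun i => ?_
    rw [← Real.exp_nat_mul, ← Real.exp_add]; congr 1; ring
  have hl : Summable (fun i : ℕ => Real.log (1 - Real.exp (-(r * (i + c))))) := by
    have := Real.summable_log_one_add_of_summable hs.neg
    simpa [sub_eq_add_neg] using this
  rw [← Real.rexp_tsum_eq_tprod (fun i => ?_) hl, Real.log_exp]
  · exact hl.hasSum.tendsto_sum_nat
  · have := s_exp_lt (x := r * (i + c)) (by positivity); linarith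

lemma s_main {c r : ℝ} (hc : 0 < c) (hr : 0 < r) :
    let X := Real.log (∏' i : ℕ, (1 - Real.exp (-r) ^ (c + (i : ℝ))))
      - (1 / 2 * Real.log (2 * Real.pi) - Real.log (Real.Gamma c)) + (c - 1 / 2) * Real.log r
      - sg (r * c) / 2 + sP (r * c) / r
    0 ≤ X ∧ X ≤ r := by
  intro X
  have hx : Tendsto (fun N : ℕ => r * ((N:ℝ) + c)) atTop atTop :=
    (tendsto_atTop_add_const_right _ c tendsto_natCast_atTop_atTop).const_mul_atTop hr
  have h := ((((((s_logprod hc hr).sub (s_stirling hc)).add_const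
    ((c - 1 / 2) * Real.log r - sg (r * c) / 2 + sP (r * c) / r)).add
      ((sf_lim.comp hx).div_const 2)).sub ((sL_lim.comp hx).div_const r)))
  have hX : Tendsto (fun N : ℕ => ∑ n ∈ Finset.range N, sg (r * (n + c)) + (sg (r * (N + c)) - sg (r * c)) / 2
      - (sP (r * (N + c)) - sP (r * c)) / r) atTop (𝓝 X) := by
    convert! h using 2
    · rename_i N
      have e1 : ∑ n ∈ Finset.range N, sg (r * (n + c)) = ∑ n ∈ Finset.range N, sf (r * (n + c))
          - (N * Real.log r + ∑ n ∈ Finset.range N, Real.log (n + c)) := by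
        have : (N:ℝ) * Real.log r = ∑ n ∈ Finset.range N, Real.log r := by simp
        rw [this, ← Finset.sum_add_distrib, ← Finset.sum_sub_distrib]
        refine Finset.sum_congr rfl fun n _ => ?_
        rw [sg, Real.log_mul hr.ne' (by positivity)]
      rw [e1]
      simp only [Function.comp]
      have e2 : sg (r * (N + c)) = sf (r * (N + c)) - (Real.log r + Real.log (N + c)) := by
        rw [sg, Real.log_mul hr.ne' (by positivity)]
      have e3 : sP (r * (N + c)) / r = sL (r * (N + c)) / r
          - (N + c) * (Real.log r + Real.log (N + c)) + (N + c) := by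
        rw [sP, Real.log_mul hr.ne' (by positivity)]; field_simp
      rw [sub_div (sP _), e2, e3]
      ring
    · simp only [X]; ring
  constructor
  · exact ge_of_tendsto' hX fun N => (s_sum hc hr N).1
  · refine le_of_tendsto' hX fun N => (s_sum hc hr N).2.trans ?_
    have h1 := sqq_bd (x := r * (N + c)) (by positivity)
    have h2 := sqq_bd (x := r * c) (by positivity)
    nlinarith [h1.2, h2.1]

/-- the asymptotic expansion of `log (u^c; u)_∞` with `u = e^{-r}`, `r → 0+`,
with error term `O(r)`. -/
theorem statement7 (c : ℝ) (hc : 0 < c) :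
    ∃ C : ℝ, 0 < C ∧ ∃ r₀ : ℝ, 0 < r₀ ∧ ∀ r : ℝ, 0 < r → r < r₀ →
      |Real.log (∏' i : ℕ, (1 - Real.exp (-r) ^ (c + (i : ℝ)))) -
          (-(Real.pi ^ 2) / (6 * r) + (1 / 2 - c) * Real.log r +
            (1 / 2) * Real.log (2 * Real.pi) - Real.log (Real.Gamma c))| ≤ C * r := by
  refine ⟨1 + c + c ^ 2, by positivity, 1, one_pos, fun r hr _ => ?_⟩
  have hm := s_main hc hr
  simp only at hm
  have hrc : 0 < r * c := by positivity
  have hg := sg_bd hrc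
  have hP := sP_bd hrc
  have hP' : |sP (r * c) / r - Real.pi ^ 2 / (6 * r)| ≤ c ^ 2 * r := by
    have : sP (r * c) / r - Real.pi ^ 2 / (6 * r) = (sP (r * c) - Real.pi ^ 2 / 6) / r := by
      field_simp
    rw [this, abs_div, abs_of_pos hr, div_le_iff₀ hr]
    nlinarith
  rw [abs_le] at hP' ⊢
  rw [neg_div]
  constructor <;> nlinarith [hm.1, hm.2, hg.1, hg.2, hP'.1, hP'.2]

end
end
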